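/- arXiv:1708.07054 — 2 statements merged into one kernel-verified Lean document; each statement's English description precedes it below -/
import Mathlib

section
/- For the domino ideal I_n (n ≥ 3), the top graded Betti number satisfies β_{n-1,3n-2}(I_n) = 1. -/
/-- The vertical domino occupying column `k` (0-indexed) of a 2×n board. -/
def Vert (k : ℕ) : Finset (ℕ × ℕ) := {(0, k), (1, k)}

/-- The horizontal domino in row `i` covering columns `k` and `k+1`. -/
def Horiz (i k : ℕ) : Finset (ℕ × ℕ) := {(i, k), (i, k + 1)}

/-- A domino on the 2×n board. -/
def IsDomino (n : ℕ) (d : Finset (ℕ × ℕ)) : Prop :=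
  (∃ k < n, d = Vert k) ∨ (∃ i < 2, ∃ k, k + 1 < n ∧ d = Horiz i k)

/-- `T` is a domino tiling of the 2×n board: a set of dominoes, pairwise disjoint,
covering exactly the cells of the board. -/
def IsTiling (n : ℕ) (T : Finset (Finset (ℕ × ℕ))) : Prop :=
  (∀ d ∈ T, IsDomino n d) ∧
  (∀ c : ℕ × ℕ, (c.1 < 2 ∧ c.2 < n) ↔ ∃ d ∈ T, c ∈ d) ∧
  (∀ d ∈ T, ∀ e ∈ T, d ≠ e → Disjoint d e)

/-- `T_n`, the set of all domino tilings of the 2×n rectangle. -/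
def Tilings (n : ℕ) : Set (Finset (Finset (ℕ × ℕ))) := {T | IsTiling n T}

open scoped Classical

/-- The variable (in the paper's 1-indexed labelling) attached to a domino of the 2×n board:
the vertical domino in column k (1-indexed) ↦ y_k = `Sum.inr k`, the top horizontal domino
starting in column k ↦ x_k = `Sum.inl k`, the bottom one ↦ x_{n-1+k} = `Sum.inl (n-1+k)`. -/
noncomputable def dominoVar (n : ℕ) (d : Finset (ℕ × ℕ)) : ℕ ⊕ ℕ :=
  if h : ∃ k, d = Vert k then Sum.inr (h.choose + 1)
  else if h2 : ∃ k, d = Horiz 0 k then Sum.inl (h2.choose + 1)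
  else if h3 : ∃ k, d = Horiz 1 k then Sum.inl (n + h3.choose)
  else Sum.inl 0

/-- The squarefree monomial (in `K[x_1,…,x_{2n-2},y_1,…,y_n]`, realized as
`MvPolynomial (ℕ ⊕ ℕ) K` with x_i = `X (Sum.inl i)` and y_i = `X (Sum.inr i)`)
associated to a tiling `T`, using the labelling of the 2×n board. -/
noncomputable def dominoMonomial (K : Type*) [Field K] (n : ℕ)
    (T : Finset (Finset (ℕ × ℕ))) : MvPolynomial (ℕ ⊕ ℕ) K :=
  ∏ d ∈ T, MvPolynomial.X (dominoVar n d)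

/-- The ideal generated by the tiling monomials of all tilings of a 2×m rectangle,
labelled as dominoes of the ambient 2×n board. -/
noncomputable def dominoIdealIn (K : Type*) [Field K] (n m : ℕ) :
    Ideal (MvPolynomial (ℕ ⊕ ℕ) K) :=
  Ideal.span {p | ∃ T, IsTiling m T ∧ p = dominoMonomial K n T}

/-- The domino ideal `I_n`. -/
noncomputable def dominoIdeal (K : Type*) [Field K] (n : ℕ) :
    Ideal (MvPolynomial (ℕ ⊕ ℕ) K) := dominoIdealIn K n n

/-- `V_n`: the ideal generated by the tilings containing the vertical domino `y_n`. -/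
noncomputable def Vn (K : Type*) [Field K] (n : ℕ) : Ideal (MvPolynomial (ℕ ⊕ ℕ) K) :=
  Ideal.span {p | ∃ T, IsTiling n T ∧ Vert (n - 1) ∈ T ∧ p = dominoMonomial K n T}

/-- `U_n`: the ideal generated by the tilings containing the two rightmost horizontal
dominoes `x_{n-1}` and `x_{2n-2}`. -/
noncomputable def Un (K : Type*) [Field K] (n : ℕ) : Ideal (MvPolynomial (ℕ ⊕ ℕ) K) :=
  Ideal.span {p | ∃ T, IsTiling n T ∧ Horiz 0 (n - 2) ∈ T ∧ Horiz 1 (n - 2) ∈ T ∧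
    p = dominoMonomial K n T}

/-- The set of (exponent vectors of) minimal monomial generators of a monomial ideal:
monomials of the ideal not strictly divisible by any other monomial of the ideal. -/
def minGens {K : Type*} [Field K] {σ : Type*} (I : Ideal (MvPolynomial σ K)) :
    Set (σ →₀ ℕ) :=
  {a | MvPolynomial.monomial a (1 : K) ∈ I ∧
      ∀ b : σ →₀ ℕ, b ≤ a → MvPolynomial.monomial b (1 : K) ∈ I → b = a}


/-- A minimal graded free resolution of an ideal `I` in a polynomial ring
`R = MvPolynomial σ K`:
`0 → F_len → ⋯ → F_1 → F_0 → I → 0`, where `F_i = ⊕_j R(-j)^{β i j}` is realized as the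
free module on the generator set `Σ j, Fin (β i j)` (a generator `⟨j, m⟩` has degree `j`).
The fields record homogeneity of the maps (entries of the matrices of `d` are homogeneous
of the appropriate degrees), minimality (all entries lie in the irrelevant maximal ideal,
i.e. every entry from a degree-`j` generator to a degree-`j'` generator with `j ≤ j'`
vanishes), exactness, surjectivity onto `I`, and that `len` is the length.
`β i j` is the (i,j)-th graded Betti number of `I`. -/
structure MinimalFreeResolution {K : Type*} [Field K] {σ : Type*}
    (I : Ideal (MvPolynomial σ K)) where
  β : ℕ → ℕ → ℕ
  len : ℕ
  d : ∀ i : ℕ, ((Σ j : ℕ, Fin (β (i + 1) j)) →₀ MvPolynomial σ K)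
      →ₗ[MvPolynomial σ K] ((Σ j : ℕ, Fin (β i j)) →₀ MvPolynomial σ K)
  ε : ((Σ j : ℕ, Fin (β 0 j)) →₀ MvPolynomial σ K) →ₗ[MvPolynomial σ K] MvPolynomial σ K
  ε_homog : ∀ g : Σ j : ℕ, Fin (β 0 j),
    ε (Finsupp.single g 1) ∈ MvPolynomial.homogeneousSubmodule σ K g.1
  ε_range : LinearMap.range ε = I
  d_homog : ∀ (i : ℕ) (g : Σ j : ℕ, Fin (β (i + 1) j)) (g' : Σ j : ℕ, Fin (β i j)),
    (d i (Finsupp.single g 1)) g' ∈ MvPolynomial.homogeneousSubmodule σ K (g.1 - g'.1)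
  d_minimal : ∀ (i : ℕ) (g : Σ j : ℕ, Fin (β (i + 1) j)) (g' : Σ j : ℕ, Fin (β i j)),
    g.1 ≤ g'.1 → (d i (Finsupp.single g 1)) g' = 0
  exact_at_zero : LinearMap.ker ε = LinearMap.range (d 0)
  exact : ∀ i : ℕ, LinearMap.ker (d i) = LinearMap.range (d (i + 1))
  len_spec : ∀ i j : ℕ, len < i → β i j = 0
  len_min : len = 0 ∨ ∃ j, β len j ≠ 0

universe u

section Ext
open CategoryTheory CategoryTheory.Abelian

variable {k : Type*} [CommRing k] {C : Type*} [Category C] [Abelian C] [Linear k C]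
  {S : ShortComplex C}

/-- Precomposition with a morphism, as a linear map. -/
noncomputable def precompLinear (k : Type*) [CommRing k] [Linear k C] {X X' : C} (f : X ⟶ X')
    (Y : C) : (X' ⟶ Y) →ₗ[k] (X ⟶ Y) where
  toFun x := f ≫ x
  map_add' _ _ := Preadditive.comp_add _ _ _ _ _ _
  map_smul' _ _ := Linear.comp_smul _ _ _ _ _ _

lemma precompLinear_bijective (hS : S.ShortExact) (Y : C)
    (h₀ : ∀ x : S.X₂ ⟶ Y, S.f ≫ x = 0) :
    Function.Bijective (precompLinear k S.g Y) := by
  have := hS.epi_g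
  constructor
  · intro x y h
    exact (cancel_epi S.g).1 h
  · intro x
    exact ⟨hS.exact.desc x (h₀ x), hS.exact.g_desc x (h₀ x)⟩

variable [HasExt C]

/-- Precomposition with the extension class of a short exact sequence, as a linear map. -/
noncomputable def extConnecting (k : Type*) [CommRing k] [Linear k C]
    (hS : S.ShortExact) (Y : C) (n : ℕ) :
    Ext S.X₁ Y n →ₗ[k] Ext S.X₃ Y (n + 1) where
  toFun x := hS.extClass.comp x (add_comm 1 n)
  map_add' _ _ := Ext.comp_add _ _ _ _
  map_smul' _ _ := Ext.comp_smul _ _ _ _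

lemma extConnecting_bijective (hS : S.ShortExact) (Y : C) (n : ℕ)
    (h₀ : ∀ x : Ext S.X₂ Y n, (Ext.mk₀ S.f).comp x (zero_add n) = 0)
    (h₁ : Subsingleton (Ext S.X₂ Y (n + 1))) :
    Function.Bijective (extConnecting k hS Y n) := by
  constructor
  · rw [injective_iff_map_eq_zero]
    intro x hx
    obtain ⟨y, rfl⟩ := Ext.contravariant_sequence_exact₁ hS Y x (add_comm 1 n) hx
    exact h₀ y
  · intro x
    exact Ext.contravariant_sequence_exact₃ hS Y x (Subsingleton.elim _ _) (add_comm 1 n)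

lemma ext_subsingleton_middle (hS : S.ShortExact) (Y : C) (n : ℕ)
    (h₁ : Subsingleton (Ext S.X₁ Y n)) (h₃ : Subsingleton (Ext S.X₃ Y n)) :
    Subsingleton (Ext S.X₂ Y n) := by
  refine subsingleton_of_forall_eq 0 fun x => ?_
  obtain ⟨y, rfl⟩ := Ext.contravariant_sequence_exact₂ hS Y x (Subsingleton.elim _ _)
  rw [Subsingleton.elim y 0, Ext.comp_zero]

lemma ext_zero_subsingleton_right (hS : S.ShortExact) (Y : C)
    (h₂ : Subsingleton (Ext S.X₂ Y 0)) : Subsingleton (Ext S.X₃ Y 0) :=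
  have := hS.epi_g
  (Ext.precomp_mk₀_injective_of_epi Y S.g).subsingleton

end Ext

section Graded
open CategoryTheory CategoryTheory.Limits MvPolynomial

/-- The category whose objects are degrees and whose morphisms are the monomials raising one
degree to another; its representations are the graded modules over a polynomial ring. -/
structure MonomialCat (σ : Type) where
  deg : ℕ

variable {σ : Type}

noncomputable instance : Category (MonomialCat σ) where
  Hom i j := {a : σ →₀ ℕ // i.deg + a.degree = j.deg}
  id i := ⟨0, by simp⟩
  comp {i j k} a b := ⟨a.1 + b.1, by rw [map_add, ← add_assoc, a.2, b.2]⟩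
  id_comp a := Subtype.ext (zero_add _)
  comp_id a := Subtype.ext (add_zero _)
  assoc a b c := Subtype.ext (add_assoc _ _ _)

/-- The morphism given by a monomial. -/
def MonomialCat.mk' {i j : ℕ} (a : σ →₀ ℕ) (h : i + a.degree = j) :
    (⟨i⟩ : MonomialCat σ) ⟶ ⟨j⟩ := ⟨a, h⟩

variable {K : Type u} [Field K]

/-- Homogeneous pieces of a module over a polynomial ring. -/
structure Pieces (K : Type u) [Field K] (σ : Type) (N : Type u) [AddCommGroup N] [Module K N]
    [Module (MvPolynomial σ K) N] where
  piece : ℕ → Submodule K N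
  smul_mem : ∀ (a : σ →₀ ℕ) (j : ℕ) (n : N), n ∈ piece j →
    (monomial a (1 : K)) • n ∈ piece (j + a.degree)

variable {N N' N'' : Type u} [AddCommGroup N] [Module K N] [Module (MvPolynomial σ K) N]
  [IsScalarTower K (MvPolynomial σ K) N]
  [AddCommGroup N'] [Module K N'] [Module (MvPolynomial σ K) N']
  [IsScalarTower K (MvPolynomial σ K) N']
  [AddCommGroup N''] [Module K N''] [Module (MvPolynomial σ K) N'']
  [IsScalarTower K (MvPolynomial σ K) N'']

namespace Pieces

/-- The graded module with the given homogeneous pieces. -/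
noncomputable def obj (G : Pieces K σ N) : MonomialCat σ ⥤ ModuleCat.{u} K where
  obj i := ModuleCat.of K (G.piece i.deg)
  map {i j} a := ModuleCat.ofHom
    (((Algebra.lsmul K K N (monomial a.1 (1 : K))).restrict
      (p := G.piece i.deg) (q := G.piece j.deg)
      fun n hn => (congrArg (fun d => monomial a.1 (1 : K) • n ∈ G.piece d) a.2).mp
        (G.smul_mem a.1 i.deg n hn)))
  map_id i := by
    ext n
    change (monomial (0 : σ →₀ ℕ) (1 : K)) • (n : N) = n
    rw [monomial_zero', C_1, one_smul]
  map_comp {i j l} a b := by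
    ext n
    change monomial (a.1 + b.1) (1 : K) • (n : N) =
      monomial b.1 (1 : K) • monomial a.1 (1 : K) • (n : N)
    rw [smul_smul, monomial_mul, one_mul, add_comm]

/-- The morphism of graded modules induced by a linear map. -/
noncomputable def hom {G : Pieces K σ N} {G' : Pieces K σ N'} (φ : N →ₗ[MvPolynomial σ K] N')
    (h : ∀ j n, n ∈ G.piece j → φ n ∈ G'.piece j) : G.obj ⟶ G'.obj where
  app i := ModuleCat.ofHom ((φ.restrictScalars K).restrict (h i.deg))
  naturality i j a := by
    ext n
    apply Subtype.ext
    exact φ.map_smul _ _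

/-- The part of a graded module lying in a submodule. -/
noncomputable def inf (G : Pieces K σ N) (Z : Submodule (MvPolynomial σ K) N) : Pieces K σ N where
  piece j := G.piece j ⊓ Z.restrictScalars K
  smul_mem a j n hn := ⟨G.smul_mem a j n hn.1, Z.smul_mem _ hn.2⟩

lemma shortExact_obj (S : ShortComplex (MonomialCat σ ⥤ ModuleCat.{u} K))
    (h : ∀ i, (S.map ((evaluation _ _).obj i)).ShortExact) : S.ShortExact := by
  have h1 : Mono S.f := (NatTrans.mono_iff_mono_app _).2 fun i => (h i).mono_f
  have h2 : Epi S.g := (NatTrans.epi_iff_epi_app _).2 fun i => (h i).epi_g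
  refine ⟨?_⟩
  rw [ShortComplex.exact_iff_isZero_homology, Functor.isZero_iff]
  intro i
  exact ((ShortComplex.exact_iff_isZero_homology _).1 (h i).exact).of_iso
    (S.mapHomologyIso ((evaluation _ _).obj i)).symm

lemma shortExact {G : Pieces K σ N} {G' : Pieces K σ N'} {G'' : Pieces K σ N''}
    (φ : N →ₗ[MvPolynomial σ K] N') (ψ : N' →ₗ[MvPolynomial σ K] N'')
    (hφ : ∀ j n, n ∈ G.piece j → φ n ∈ G'.piece j)
    (hψ : ∀ j n, n ∈ G'.piece j → ψ n ∈ G''.piece j)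
    (inj : ∀ j n, n ∈ G.piece j → φ n = 0 → n = 0)
    (zero : ∀ j n, n ∈ G.piece j → ψ (φ n) = 0)
    (exact : ∀ j n, n ∈ G'.piece j → ψ n = 0 → ∃ m ∈ G.piece j, φ m = n)
    (surj : ∀ j n, n ∈ G''.piece j → ∃ m ∈ G'.piece j, ψ m = n) :
    (ShortComplex.mk (hom φ hφ) (hom ψ hψ) (by
      ext i n
      exact Subtype.ext (zero i.deg n.1 n.2))).ShortExact := by
  apply shortExact_obj
  intro i
  have h1 : Mono ((hom φ hφ).app i) := by
    rw [ModuleCat.mono_iff_injective, injective_iff_map_eq_zero]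
    intro n hn
    exact Subtype.ext (inj i.deg n.1 n.2 (congrArg Subtype.val hn))
  have h2 : Epi ((hom ψ hψ).app i) := by
    rw [ModuleCat.epi_iff_surjective]
    intro n
    obtain ⟨m, hm, e⟩ := surj i.deg n.1 n.2
    exact ⟨⟨m, hm⟩, Subtype.ext e⟩
  refine @ShortComplex.ShortExact.mk _ _ _ _ ?_ h1 h2
  rw [ShortComplex.moduleCat_exact_iff]
  intro n hn
  obtain ⟨m, hm, e⟩ := exact i.deg n.1 n.2 (congrArg Subtype.val hn)
  exact ⟨⟨m, hm⟩, Subtype.ext e⟩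

section Free

variable {ι : Type} (deg : ι → ℕ)

/-- The homogeneous pieces of the free module with generators of the given degrees. -/
noncomputable def free (K : Type u) [Field K] (σ : Type) {ι : Type} (deg : ι → ℕ) :
    Pieces K σ (ι →₀ MvPolynomial σ K) where
  piece j := Submodule.span K
    {n | ∃ g a, deg g + a.degree = j ∧ n = Finsupp.single g (monomial a (1 : K))}
  smul_mem a j n hn := by
    induction hn using Submodule.span_induction with
    | mem x hx =>
      obtain ⟨g, b, hb, rfl⟩ := hx
      refine Submodule.subset_span ⟨g, a + b, ?_, ?_⟩
      · rw [map_add]; omega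
      · rw [Finsupp.smul_single, smul_eq_mul, monomial_mul, one_mul]
    | zero => rw [smul_zero]; exact Submodule.zero_mem _
    | add x y _ _ hx hy => rw [smul_add]; exact Submodule.add_mem _ hx hy
    | smul c x _ hx => rw [smul_comm]; exact Submodule.smul_mem _ c hx

variable {deg} in
lemma single_mem_free (g : ι) : Finsupp.single g 1 ∈ (free K σ deg).piece (deg g) :=
  Submodule.subset_span ⟨g, 0, by simp, rfl⟩

/-- The basis of a free module over a polynomial ring consisting of monomials. -/
noncomputable def monomialBasis (K : Type u) [Field K] (σ ι : Type) :
    Module.Basis (Σ _ : ι, σ →₀ ℕ) K (ι →₀ MvPolynomial σ K) :=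
  Finsupp.basis fun _ => basisMonomials σ K

lemma monomialBasis_apply (g : ι) (a : σ →₀ ℕ) :
    monomialBasis K σ ι ⟨g, a⟩ = Finsupp.single g (monomial a 1) := by
  simp [monomialBasis, Finsupp.coe_basis]

/-- The extension to a free module of a choice of images of the generators. -/
noncomputable def liftAux (X : MonomialCat σ ⥤ ModuleCat.{u} K) (x : ∀ g, X.obj ⟨deg g⟩)
    (j : ℕ) : (ι →₀ MvPolynomial σ K) →ₗ[K] X.obj ⟨j⟩ :=
  (monomialBasis K σ ι).constr K fun p =>
    if h : deg p.1 + p.2.degree = j then X.map (MonomialCat.mk' p.2 h) (x p.1) else 0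

lemma liftAux_single (X : MonomialCat σ ⥤ ModuleCat.{u} K) (x : ∀ g, X.obj ⟨deg g⟩)
    (j : ℕ) (g : ι) (a : σ →₀ ℕ) :
    liftAux deg X x j (Finsupp.single g (monomial a 1)) =
      if h : deg g + a.degree = j then X.map (MonomialCat.mk' a h) (x g) else 0 := by
  rw [← monomialBasis_apply, liftAux, Module.Basis.constr_basis]

lemma liftAux_smul (X : MonomialCat σ ⥤ ModuleCat.{u} K) (x : ∀ g, X.obj ⟨deg g⟩)
    (i j : ℕ) (a : σ →₀ ℕ) (h : i + a.degree = j) (n : ι →₀ MvPolynomial σ K) :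
    liftAux deg X x j (monomial a (1 : K) • n) =
      X.map (MonomialCat.mk' a h) (liftAux deg X x i n) := by
  have : (liftAux deg X x j) ∘ₗ (Algebra.lsmul K K _ (monomial a (1 : K))) =
      (X.map (MonomialCat.mk' a h)).hom ∘ₗ liftAux deg X x i := by
    apply (monomialBasis K σ ι).ext
    rintro ⟨g, b⟩
    rw [monomialBasis_apply, LinearMap.comp_apply, LinearMap.comp_apply, Algebra.lsmul_coe]
    beta_reduce
    rw [Finsupp.smul_single, smul_eq_mul, monomial_mul, one_mul, liftAux_single, liftAux_single]
    by_cases hb : deg g + b.degree = i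
    · rw [dif_pos hb, dif_pos (by rw [map_add]; omega), ← ModuleCat.comp_apply, ← X.map_comp]
      congr 3
      exact Subtype.ext (add_comm _ _)
    · rw [dif_neg hb, dif_neg (by rw [map_add]; omega), map_zero]
  exact LinearMap.congr_fun this n

/-- The morphism from a free graded module given by the images of the generators. -/
noncomputable def lift (X : MonomialCat σ ⥤ ModuleCat.{u} K) (x : ∀ g, X.obj ⟨deg g⟩) :
    (free K σ deg).obj ⟶ X where
  app i := ModuleCat.ofHom (liftAux deg X x i.deg ∘ₗ Submodule.subtype _)
  naturality i j a := by
    ext n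
    exact liftAux_smul deg X x i.deg j.deg a.1 a.2 n.1

/-- Morphisms from a free graded module are determined by the images of the generators. -/
noncomputable def freeEquiv (X : MonomialCat σ ⥤ ModuleCat.{u} K) :
    ((free K σ deg).obj ⟶ X) ≃ₗ[K] (∀ g, X.obj ⟨deg g⟩) := by
  refine LinearEquiv.ofBijective
    { toFun f g := f.app ⟨deg g⟩ ⟨Finsupp.single g 1, single_mem_free g⟩
      map_add' _ _ := rfl
      map_smul' _ _ := rfl } ⟨?_, ?_⟩
  · rw [injective_iff_map_eq_zero]
    intro f hf
    ext ⟨j⟩ ⟨n, hn⟩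
    change f.app ⟨j⟩ ⟨n, hn⟩ = 0
    induction hn using Submodule.span_induction with
    | mem x hx =>
      obtain ⟨g, a, h, rfl⟩ := hx
      have h1 := ConcreteCategory.congr_hom (f.naturality (MonomialCat.mk' a h))
        ⟨Finsupp.single g 1, single_mem_free g⟩
      have h2 := congrFun hf g
      change f.app ⟨deg g⟩ ⟨Finsupp.single g 1, single_mem_free g⟩ = 0 at h2
      have h3 := h1.trans ((congrArg (X.map (MonomialCat.mk' a h)) h2).trans (map_zero _))
      refine Eq.trans ?_ h3
      change _ = f.app ⟨j⟩ _
      congr 1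
      apply Subtype.ext
      change _ = monomial a (1 : K) • Finsupp.single g 1
      rw [Finsupp.smul_single, smul_eq_mul, mul_one]
    | zero => exact map_zero _
    | add x y hx hy h1 h2 =>
      have := map_add (f.app ⟨j⟩).hom ⟨x, hx⟩ ⟨y, hy⟩
      exact this.trans (by rw [h1, h2, add_zero])
    | smul c x hx h1 =>
      have := map_smul (f.app ⟨j⟩).hom c ⟨x, hx⟩
      exact this.trans (by rw [h1, smul_zero])
  · intro x
    refine ⟨lift deg X x, funext fun g => ?_⟩
    change liftAux deg X x (deg g) (Finsupp.single g (monomial 0 1)) = x g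
    rw [liftAux_single, dif_pos (by simp)]
    exact ConcreteCategory.congr_hom (X.map_id ⟨deg g⟩) (x g)

instance projective_free : Projective (free K σ deg).obj where
  factors {E X} f e he := by
    have hs : ∀ i, Function.Surjective (e.app i) := fun i =>
      (ModuleCat.epi_iff_surjective _).1 ((NatTrans.epi_iff_epi_app _).1 he i)
    choose x hx using fun g => hs _ (freeEquiv deg X f g)
    refine ⟨(freeEquiv deg E).symm x, (freeEquiv deg X).injective (funext fun g => ?_)⟩
    rw [← hx g]
    exact congrArg _ (congrFun ((freeEquiv deg E).apply_symm_apply x) g)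

end Free

/-- The simple graded module concentrated in a single degree. -/
noncomputable def simple (K : Type u) [Field K] (σ : Type) (j : ℕ) :
    MonomialCat σ ⥤ ModuleCat.{u} K where
  obj i := ModuleCat.of K ((if i.deg = j then ⊤ else ⊥ : Submodule K K))
  map {i i'} a := ModuleCat.ofHom (if h : i.deg = i'.deg then
    Submodule.inclusion (le_of_eq (by rw [h])) else 0)
  map_id i := by
    rw [dif_pos rfl]; rfl
  map_comp {i i' i''} a b := by
    have ha := a.2
    have hb := b.2
    by_cases h : i.deg = i'.deg
    · by_cases h' : i'.deg = i''.deg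
      · rw [dif_pos h, dif_pos h', dif_pos (h.trans h')]; rfl
      · rw [dif_neg h', dif_neg (h ▸ h')]; rfl
    · rw [dif_neg h, dif_neg (by omega)]; ext x
      exact congrArg Subtype.val (map_zero (ModuleCat.Hom.hom (ModuleCat.ofHom _))).symm

lemma simple_map_eq_zero {i i' : MonomialCat σ} (j : ℕ) (a : i ⟶ i') (h : i.deg ≠ i'.deg) :
    (simple K σ j).map a = 0 := by
  change ModuleCat.ofHom _ = 0
  rw [dif_neg h]; rfl

/-- The dimension of the space of morphisms from a free graded module to a simple one. -/
lemma nonempty_freeEquiv_simple {ι : Type} (deg : ι → ℕ) (j b : ℕ)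
    (e : {g // deg g = j} ≃ Fin b) :
    Nonempty (((free K σ deg).obj ⟶ simple K σ j) ≃ₗ[K] (Fin b → K)) := by
  suffices f : (∀ g, (simple K σ j).obj ⟨deg g⟩) ≃ₗ[K] ({g // deg g = j} → K) from
    ⟨((freeEquiv deg _).trans f).trans (LinearEquiv.funCongrLeft K K e.symm)⟩
  refine LinearEquiv.ofBijective
    { toFun f g := (f g.1 : (if deg g.1 = j then ⊤ else ⊥ : Submodule K K)).1
      map_add' _ _ := rfl
      map_smul' _ _ := rfl } ⟨?_, ?_⟩
  · intro f f' h
    funext g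
    apply Subtype.ext
    by_cases hg : deg g = j
    · exact congrFun h ⟨g, hg⟩
    · have key : ∀ x : (if deg g = j then ⊤ else ⊥ : Submodule K K), x.1 = 0 := fun x => by
        have := x.2
        simpa only [if_neg hg, Submodule.mem_bot] using this
      exact (key (f g)).trans (key (f' g)).symm
  · intro x
    refine ⟨fun g => ⟨if h : deg g = j then x ⟨g, h⟩ else 0, ?_⟩, funext fun g => ?_⟩
    · change _ ∈ (if deg g = j then ⊤ else ⊥ : Submodule K K)
      split_ifs
      · exact Submodule.mem_top
      · exact Submodule.zero_mem _
    · exact dif_pos g.2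

end Pieces
end Graded

section Resolution
open CategoryTheory CategoryTheory.Limits CategoryTheory.Abelian MvPolynomial

noncomputable instance hasExtMonomialCat (K : Type u) [Field K] (σ : Type) :
    HasExt.{u + 1} (MonomialCat σ ⥤ ModuleCat.{u} K) :=
  HasExt.standard _

variable {σ : Type} {K : Type u} [Field K]

namespace Pieces

variable {N : Type u} [AddCommGroup N] [Module K N] [Module (MvPolynomial σ K) N]

/-- The polynomial ring with its grading by total degree. -/
noncomputable def ring (K : Type u) [Field K] (σ : Type) : Pieces K σ (MvPolynomial σ K) where
  piece j := homogeneousSubmodule σ K j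
  smul_mem a j n hn := by
    rw [smul_eq_mul, mem_homogeneousSubmodule, add_comm]
    exact (isHomogeneous_monomial _ rfl).mul hn

/-- The pieces are independent: there are projections onto them. -/
def HasProj (G : Pieces K σ N) : Prop :=
  ∀ j, ∃ c : N →ₗ[K] N, ∀ i n, n ∈ G.piece i → c n = if i = j then n else 0

lemma hasProj_ring : (ring K σ).HasProj := fun j => by
  refine ⟨homogeneousComponent j, fun i n hn => ?_⟩
  rw [homogeneousComponent_of_mem hn]
  simp only [eq_comm]

variable {ι : Type} {deg : ι → ℕ}

lemma free_proj (j : ℕ) : ∃ c : (ι →₀ MvPolynomial σ K) →ₗ[K] (ι →₀ MvPolynomial σ K),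
    (∀ g a, c (Finsupp.single g (monomial a 1)) =
      if deg g + a.degree = j then Finsupp.single g (monomial a 1) else 0) ∧
    ∀ n, c n ∈ (free K σ deg).piece j := by
  let c : (ι →₀ MvPolynomial σ K) →ₗ[K] (ι →₀ MvPolynomial σ K) :=
    (monomialBasis K σ ι).constr K fun p =>
      if deg p.1 + p.2.degree = j then Finsupp.single p.1 (monomial p.2 1) else 0
  have hc : ∀ g a, c (Finsupp.single g (monomial a 1)) =
      if deg g + a.degree = j then Finsupp.single g (monomial a 1) else 0 := fun g a => by
    rw [← monomialBasis_apply, Module.Basis.constr_basis]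
    simp only [monomialBasis_apply]
  refine ⟨c, hc, fun n => ?_⟩
  induction (monomialBasis K σ ι).mem_span n using Submodule.span_induction with
  | zero => rw [map_zero]; exact Submodule.zero_mem _
  | mem _ hp =>
    obtain ⟨⟨g, a⟩, rfl⟩ := hp
    rw [monomialBasis_apply, hc]
    split_ifs with h
    · exact Submodule.subset_span ⟨g, a, h, rfl⟩
    · exact Submodule.zero_mem _
  | add x y _ _ hx hy => rw [map_add]; exact Submodule.add_mem _ hx hy
  | smul r x _ hx => rw [map_smul]; exact Submodule.smul_mem _ _ hx

lemma hasProj_free : (free K σ deg).HasProj := fun j => by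
  obtain ⟨c, hc, -⟩ := free_proj (K := K) (σ := σ) (deg := deg) j
  refine ⟨c, fun i n hn => ?_⟩
  induction hn using Submodule.span_induction with
  | mem x hx =>
    obtain ⟨g, a, h, rfl⟩ := hx
    rw [hc, h]
  | zero => simp
  | add x y _ _ hx hy => rw [map_add, hx, hy]; split_ifs <;> simp
  | smul r x _ hx => rw [map_smul, hx]; split_ifs <;> simp

lemma single_mem_free_of_isHomogeneous {g : ι} {r : MvPolynomial σ K} {e j : ℕ}
    (hr : r.IsHomogeneous e) (h : deg g + e = j) :
    Finsupp.single g r ∈ (free K σ deg).piece j := by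
  rw [r.as_sum, ← Finsupp.singleAddHom_apply, map_sum]
  refine Submodule.sum_mem _ fun a ha => ?_
  have : monomial a (coeff a r) = (coeff a r) • monomial a (1 : K) := by
    rw [smul_monomial, smul_eq_mul, mul_one]
  rw [this, Finsupp.singleAddHom_apply, ← Finsupp.smul_single]
  refine Submodule.smul_mem _ _ (Submodule.subset_span ⟨g, a, ?_, rfl⟩)
  rw [← h, Finsupp.degree_eq_weight_one]
  exact congrArg _ (hr (mem_support_iff.1 ha))

lemma mem_free_of_forall {n : ι →₀ MvPolynomial σ K} {j : ℕ}
    (h : ∀ g, n g ≠ 0 → deg g ≤ j ∧ (n g).IsHomogeneous (j - deg g)) :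
    n ∈ (free K σ deg).piece j := by
  rw [← Finsupp.sum_single n]
  refine Submodule.sum_mem _ fun g hg => ?_
  obtain ⟨h1, h2⟩ := h g (Finsupp.mem_support_iff.1 hg)
  exact single_mem_free_of_isHomogeneous h2 (by omega)

variable [IsScalarTower K (MvPolynomial σ K) N]

lemma map_mem_of_forall_single {G : Pieces K σ N}
    (φ : (ι →₀ MvPolynomial σ K) →ₗ[MvPolynomial σ K] N)
    (h : ∀ g, φ (Finsupp.single g 1) ∈ G.piece (deg g)) (j : ℕ) (n : ι →₀ MvPolynomial σ K)
    (hn : n ∈ (free K σ deg).piece j) : φ n ∈ G.piece j := by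
  induction hn using Submodule.span_induction with
  | mem x hx =>
    obtain ⟨g, a, e, rfl⟩ := hx
    have : Finsupp.single g (monomial a (1 : K)) = monomial a (1 : K) • Finsupp.single g 1 := by
      rw [Finsupp.smul_single, smul_eq_mul, mul_one]
    rw [this, map_smul, ← e]
    exact G.smul_mem a _ _ (h g)
  | zero => rw [map_zero]; exact Submodule.zero_mem _
  | add x y _ _ hx hy => rw [map_add]; exact Submodule.add_mem _ hx hy
  | smul c x _ hx =>
    rw [← LinearMap.coe_restrictScalars K φ, map_smul]; exact Submodule.smul_mem _ c hx

lemma exists_mem_free_map_eq {G : Pieces K σ N} (hG : G.HasProj)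
    (φ : (ι →₀ MvPolynomial σ K) →ₗ[MvPolynomial σ K] N)
    (h : ∀ g, φ (Finsupp.single g 1) ∈ G.piece (deg g)) (j : ℕ) (n : ι →₀ MvPolynomial σ K)
    (hn : φ n ∈ G.piece j) : ∃ m ∈ (free K σ deg).piece j, φ m = φ n := by
  obtain ⟨c, hc, hc'⟩ := free_proj (K := K) (σ := σ) (deg := deg) j
  obtain ⟨c', hc''⟩ := hG j
  refine ⟨c n, hc' n, ?_⟩
  have key : φ.restrictScalars K ∘ₗ c = c' ∘ₗ φ.restrictScalars K := by
    apply (monomialBasis K σ ι).ext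
    rintro ⟨g, a⟩
    have : φ (Finsupp.single g (monomial a 1)) ∈ G.piece (deg g + a.degree) :=
      map_mem_of_forall_single φ h _ _ (Submodule.subset_span ⟨g, a, rfl, rfl⟩)
    rw [monomialBasis_apply, LinearMap.comp_apply, LinearMap.comp_apply, hc,
      LinearMap.restrictScalars_apply, LinearMap.restrictScalars_apply, hc'' _ _ this]
    split_ifs <;> simp
  have h1 := LinearMap.congr_fun key n
  have h2 := hc'' _ _ hn
  rw [if_pos rfl] at h2
  exact h1.trans h2

/-- The short exact sequence attached to a graded map out of a free module. -/
lemma shortExact_free {G : Pieces K σ N} (hG : G.HasProj)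
    (φ : (ι →₀ MvPolynomial σ K) →ₗ[MvPolynomial σ K] N)
    (h : ∀ g, φ (Finsupp.single g 1) ∈ G.piece (deg g)) :
    (ShortComplex.mk
      (hom (G := (free K σ deg).inf (LinearMap.ker φ)) (G' := free K σ deg)
        LinearMap.id fun _ _ hn => hn.1)
      (hom (G' := G.inf (LinearMap.range φ)) φ
        fun j n hn => ⟨map_mem_of_forall_single φ h j n hn, ⟨n, rfl⟩⟩)
      (by ext i n; exact Subtype.ext n.2.2)).ShortExact :=
  shortExact (G := (free K σ deg).inf (LinearMap.ker φ)) (G' := free K σ deg)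
    (G'' := G.inf (LinearMap.range φ)) LinearMap.id φ _ _ (fun _ _ _ e => e) (fun _ _ hn => hn.2)
    (fun _ n hn e => ⟨n, ⟨hn, e⟩, rfl⟩) (by
      rintro j _ ⟨hn, ⟨n, rfl⟩⟩
      exact exists_mem_free_map_eq hG φ h j n hn)

lemma app_simple_eq_zero {j : ℕ} (f : (free K σ deg).obj ⟶ simple K σ j)
    (n : (free K σ deg).piece j) (hn : ∀ g, deg g = j → n.1 g = 0) :
    f.app ⟨j⟩ n = 0 := by
  obtain ⟨x, rfl⟩ := (freeEquiv deg _).symm.surjective f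
  have hl : (freeEquiv deg (simple K σ j)).symm x = lift deg _ x := by
    rw [LinearEquiv.symm_apply_eq]
    symm
    funext g
    change liftAux deg (simple K σ j) x (deg g) (Finsupp.single g (monomial 0 1)) = x g
    rw [liftAux_single, dif_pos (by simp)]
    exact ConcreteCategory.congr_hom ((simple K σ j).map_id ⟨deg g⟩) (x g)
  rw [hl]
  change liftAux deg (simple K σ j) x j n.1 = 0
  have key : ∀ g r, deg g ≠ j →
      liftAux deg (simple K σ j) x j (Finsupp.single g r) = 0 := by
    intro g r hg
    induction r using MvPolynomial.induction_on' with
    | monomial a c =>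
      have : Finsupp.single g (monomial a c) = c • Finsupp.single g (monomial a (1 : K)) := by
        rw [Finsupp.smul_single, smul_monomial, smul_eq_mul, mul_one]
      rw [this, map_smul, liftAux_single]
      split_ifs with h
      · rw [simple_map_eq_zero _ _ hg]; exact smul_zero _
      · exact smul_zero _
    | add p q hp hq => rw [Finsupp.single_add, map_add, hp, hq, add_zero]
  rw [← Finsupp.sum_single n.1, Finsupp.sum, map_sum]
  refine Finset.sum_eq_zero fun g hg => key g _ fun e => ?_
  exact Finsupp.mem_support_iff.1 hg (hn g e)

lemma comp_eq_zero_of_forall {Z : Submodule (MvPolynomial σ K) (ι →₀ MvPolynomial σ K)} {j : ℕ}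
    (f : (free K σ deg).obj ⟶ simple K σ j)
    (h : ∀ n ∈ (free K σ deg).piece j, n ∈ Z → ∀ g, deg g = j → n g = 0) :
    hom (G := (free K σ deg).inf Z) (G' := free K σ deg) LinearMap.id (fun _ _ hn => hn.1) ≫ f =
      0 := by
  ext ⟨i⟩ n
  by_cases hi : i = j
  · subst hi
    exact app_simple_eq_zero f ⟨n.1, n.2.1⟩ (h n.1 n.2.1 n.2.2)
  · have key : ∀ x : (if i = j then ⊤ else ⊥ : Submodule K K), x.1 = 0 := fun x => by
      have := x.2
      simpa only [if_neg hi, Submodule.mem_bot] using this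
    exact Subtype.ext ((key _).trans (key _).symm)

lemma ext_range_zero {G : Pieces K σ N} (hG : G.HasProj)
    (φ : (ι →₀ MvPolynomial σ K) →ₗ[MvPolynomial σ K] N)
    (h : ∀ g, φ (Finsupp.single g 1) ∈ G.piece (deg g)) (j b : ℕ) (e : {g // deg g = j} ≃ Fin b)
    (hmin : ∀ n ∈ (free K σ deg).piece j, φ n = 0 → ∀ g, deg g = j → n g = 0) :
    Nonempty (Ext (G.inf (LinearMap.range φ)).obj (simple K σ j) 0 ≃ₗ[K] (Fin b → K)) := by
  obtain ⟨E⟩ := nonempty_freeEquiv_simple (K := K) (σ := σ) deg j b e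
  refine ⟨Ext.linearEquiv₀.trans ((LinearEquiv.ofBijective _
    (precompLinear_bijective (k := K) (shortExact_free hG φ h) (simple K σ j) ?_)).trans E)⟩
  exact fun f => comp_eq_zero_of_forall f hmin

lemma ext_range_succ {G : Pieces K σ N} (hG : G.HasProj)
    (φ : (ι →₀ MvPolynomial σ K) →ₗ[MvPolynomial σ K] N)
    (h : ∀ g, φ (Finsupp.single g 1) ∈ G.piece (deg g)) (j p : ℕ)
    (hmin : ∀ n ∈ (free K σ deg).piece j, φ n = 0 → ∀ g, deg g = j → n g = 0) :
    Nonempty (Ext ((free K σ deg).inf (LinearMap.ker φ)).obj (simple K σ j) p ≃ₗ[K]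
      Ext (G.inf (LinearMap.range φ)).obj (simple K σ j) (p + 1)) := by
  refine ⟨LinearEquiv.ofBijective _ (extConnecting_bijective (k := K)
    (shortExact_free hG φ h) (simple K σ j) p ?_ (Ext.subsingleton_of_projective _ _ p))⟩
  intro x
  cases p with
  | zero =>
    obtain ⟨f, rfl⟩ := Ext.addEquiv₀.symm.surjective x
    rw [Ext.addEquiv₀_symm_apply, Ext.mk₀_comp_mk₀]
    exact (congrArg Ext.mk₀ (comp_eq_zero_of_forall f hmin)).trans (Ext.mk₀_zero _ _)
  | succ p =>
    have := Ext.subsingleton_of_projective (free K σ deg).obj (simple K σ j) p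
    obtain rfl : x = 0 := Subsingleton.elim x 0
    exact Ext.comp_zero _ _ _ _ _

end Pieces

/-- The graded module given by an ideal of a polynomial ring. -/
noncomputable abbrev idealObj (I : Ideal (MvPolynomial σ K)) : MonomialCat σ ⥤ ModuleCat.{u} K :=
  ((Pieces.ring K σ).inf I).obj

namespace MinimalFreeResolution

variable {I : Ideal (MvPolynomial σ K)} (F : MinimalFreeResolution I)

/-- The graded free module in a given homological degree. -/
noncomputable abbrev freePieces (i : ℕ) :
    Pieces K σ ((Σ j : ℕ, Fin (F.β i j)) →₀ MvPolynomial σ K) :=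
  Pieces.free K σ Sigma.fst

lemma d_mem (i : ℕ) (g : Σ j : ℕ, Fin (F.β (i + 1) j)) :
    F.d i (Finsupp.single g 1) ∈ (F.freePieces i).piece g.1 := by
  refine Pieces.mem_free_of_forall fun g' hg' => ⟨?_, F.d_homog i g g'⟩
  by_contra hlt
  exact hg' (F.d_minimal i g g' (by omega))

lemma d_apply_eq_zero (i j : ℕ) (m : (Σ j : ℕ, Fin (F.β (i + 1) j)) →₀ MvPolynomial σ K)
    (hm : m ∈ (F.freePieces (i + 1)).piece j) (g' : Σ j : ℕ, Fin (F.β i j)) (hg' : g'.1 = j) :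
    F.d i m g' = 0 := by
  induction hm using Submodule.span_induction with
  | mem x hx =>
    obtain ⟨g, a, e, rfl⟩ := hx
    have : Finsupp.single g (monomial a (1 : K)) = monomial a (1 : K) • Finsupp.single g 1 := by
      rw [Finsupp.smul_single, smul_eq_mul, mul_one]
    rw [this, map_smul, Finsupp.smul_apply, F.d_minimal i g g' (by omega), smul_zero]
  | zero => rw [map_zero, Finsupp.zero_apply]
  | add x y _ _ hx hy => rw [map_add, Finsupp.add_apply, hx, hy, add_zero]
  | smul c x _ hx =>
    rw [← LinearMap.coe_restrictScalars K (F.d i), map_smul, Finsupp.smul_apply,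
      LinearMap.coe_restrictScalars, hx, smul_zero]

lemma apply_eq_zero_of_mem_range (i j : ℕ) (n : (Σ j : ℕ, Fin (F.β i j)) →₀ MvPolynomial σ K)
    (hn : n ∈ (F.freePieces i).piece j) (h : n ∈ LinearMap.range (F.d i))
    (g : Σ j : ℕ, Fin (F.β i j)) (hg : g.1 = j) : n g = 0 := by
  obtain ⟨m, rfl⟩ := h
  obtain ⟨m', hm', e⟩ := Pieces.exists_mem_free_map_eq Pieces.hasProj_free (F.d i) (F.d_mem i) j m hn
  rw [← e]
  exact F.d_apply_eq_zero i j m' hm' g hg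

/-- The generators of a given degree. -/
def generatorsEquiv (i j : ℕ) : {g : Σ j : ℕ, Fin (F.β i j) // g.1 = j} ≃ Fin (F.β i j) :=
  Equiv.sigmaSubtype j

lemma nonempty_ext_syzygy (p : ℕ) : ∀ i j, Nonempty (Ext
    ((F.freePieces i).inf (LinearMap.range (F.d i))).obj (Pieces.simple K σ j) p ≃ₗ[K]
      (Fin (F.β (i + 1 + p) j) → K)) := by
  induction p with
  | zero =>
    intro i j
    refine Pieces.ext_range_zero Pieces.hasProj_free (F.d i) (F.d_mem i) j _
      (F.generatorsEquiv (i + 1) j) fun n hn h => ?_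
    refine F.apply_eq_zero_of_mem_range (i + 1) j n hn ?_
    rwa [← F.exact]
  | succ p ih =>
    intro i j
    obtain ⟨E⟩ := Pieces.ext_range_succ Pieces.hasProj_free (F.d i) (F.d_mem i) j p
      fun n hn h => F.apply_eq_zero_of_mem_range (i + 1) j n hn (by rwa [← F.exact])
    rw [F.exact] at E
    obtain ⟨E'⟩ := ih (i + 1) j
    rw [show i + 1 + (p + 1) = i + 1 + 1 + p by omega]
    exact ⟨E.symm.trans E'⟩

/-- Betti numbers are dimensions of graded pieces of extension modules. -/
theorem nonempty_ext_ideal (p j : ℕ) :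
    Nonempty (Ext (idealObj I) (Pieces.simple K σ j) p ≃ₗ[K] (Fin (F.β p j) → K)) := by
  have hmin : ∀ n ∈ (F.freePieces 0).piece j, F.ε n = 0 →
      ∀ g : Σ j : ℕ, Fin (F.β 0 j), g.1 = j → n g = 0 :=
    fun n hn h => F.apply_eq_zero_of_mem_range 0 j n hn (by rwa [← F.exact_at_zero])
  have hI : idealObj I = ((Pieces.ring K σ).inf (LinearMap.range F.ε)).obj := by
    rw [F.ε_range]
  rw [hI]
  cases p with
  | zero =>
    exact Pieces.ext_range_zero Pieces.hasProj_ring F.ε F.ε_homog j _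
      (F.generatorsEquiv 0 j) hmin
  | succ p =>
    obtain ⟨E⟩ := Pieces.ext_range_succ Pieces.hasProj_ring F.ε F.ε_homog j p hmin
    rw [F.exact_at_zero] at E
    obtain ⟨E'⟩ := F.nonempty_ext_syzygy p 0 j
    rw [show p + 1 = 0 + 1 + p by omega]
    rw [show p + 1 = 0 + 1 + p by omega] at E
    exact ⟨E.symm.trans E'⟩

end MinimalFreeResolution
end Resolution

section GradedIdeals
open CategoryTheory CategoryTheory.Limits CategoryTheory.Abelian MvPolynomial

variable {σ : Type} {K : Type u} [Field K]

attribute [local instance] MvPolynomial.gradedAlgebra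

lemma ext_subsingleton_of_isZero {X : MonomialCat σ ⥤ ModuleCat.{u} K} (h : IsZero X)
    (Y : MonomialCat σ ⥤ ModuleCat.{u} K) (i : ℕ) : Subsingleton (Ext X Y i) := by
  refine subsingleton_of_forall_eq 0 fun x => ?_
  rw [← Ext.mk₀_id_comp x, h.eq_of_src (𝟙 X) 0, Ext.mk₀_zero, Ext.zero_comp]

lemma nonempty_linearEquiv_fin_zero {M : Type*} [AddCommGroup M] [Module K M]
    [Subsingleton M] {b : ℕ} (hb : b = 0) : Nonempty (M ≃ₗ[K] (Fin b → K)) := by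
  subst hb
  exact ⟨LinearEquiv.ofBijective 0
    ⟨Function.injective_of_subsingleton _, fun x => ⟨0, Subsingleton.elim _ _⟩⟩⟩

lemma nonempty_ext_principal {q : MvPolynomial σ K} (hq : q ≠ 0) {k : ℕ}
    (hk : q.IsHomogeneous k) (i j : ℕ) :
    Nonempty (Ext (idealObj (Ideal.span {q})) (Pieces.simple K σ j) i ≃ₗ[K]
      (Fin (if j = k ∧ i = 0 then 1 else 0) → K)) := by
  let φ : (Unit →₀ MvPolynomial σ K) →ₗ[MvPolynomial σ K] MvPolynomial σ K :=
    Finsupp.linearCombination _ fun _ => q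
  have hφ : ∀ n, φ n = n () * q := fun n => by
    simp [φ, Finsupp.linearCombination_apply, Finsupp.sum_fintype]
  have hinj : ∀ n, φ n = 0 → n = 0 := fun n hn => by
    rw [hφ] at hn
    exact Finsupp.ext fun _ => (mul_eq_zero.1 hn).resolve_right hq
  have hI : Ideal.span {q} = LinearMap.range φ := by
    ext r
    rw [Ideal.mem_span_singleton', LinearMap.mem_range]
    constructor
    · rintro ⟨a, rfl⟩
      exact ⟨Finsupp.single () a, by rw [hφ, Finsupp.single_eq_same]⟩
    · rintro ⟨n, rfl⟩
      exact ⟨n (), (hφ n).symm⟩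
  have h1 : ∀ g : Unit, φ (Finsupp.single g 1) ∈ (Pieces.ring K σ).piece k := fun g => by
    rw [hφ, Finsupp.single_eq_same, one_mul]
    exact hk
  have hmin : ∀ n ∈ (Pieces.free K σ fun _ : Unit => k).piece j, φ n = 0 →
      ∀ g, k = j → n g = 0 := fun n _ hn g _ => by
    rw [hinj n hn, Finsupp.zero_apply]
  rw [hI]
  cases i with
  | zero =>
    refine Pieces.ext_range_zero Pieces.hasProj_ring φ h1 j _ ?_ hmin
    by_cases h : j = k
    · rw [if_pos ⟨h, rfl⟩]
      exact ⟨fun _ => 0, fun _ => ⟨(), h.symm⟩, fun _ => rfl, fun _ => Subsingleton.elim _ _⟩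
    · rw [if_neg fun h' => h h'.1]
      exact ⟨fun g => (h g.2.symm).elim, fun x => x.elim0, fun g => (h g.2.symm).elim,
        fun x => x.elim0⟩
  | succ i =>
    obtain ⟨E⟩ := Pieces.ext_range_succ Pieces.hasProj_ring φ h1 j i hmin
    have : IsZero ((Pieces.free K σ fun _ : Unit => k).inf (LinearMap.ker φ)).obj := by
      rw [Functor.isZero_iff]
      intro d
      refine ModuleCat.isZero_of_iff_subsingleton.2 (subsingleton_of_forall_eq 0 ?_)
      exact fun n => Subtype.ext (hinj n.1 n.2.2)
    have := ext_subsingleton_of_isZero this (Pieces.simple K σ j) i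
    have := E.symm.toEquiv.subsingleton
    exact nonempty_linearEquiv_fin_zero (if_neg fun h => Nat.succ_ne_zero i h.2)

/-- The direct sum of two ideals as a graded module. -/
noncomputable def prodPieces (A B : Ideal (MvPolynomial σ K)) :
    Pieces K σ (MvPolynomial σ K × MvPolynomial σ K) where
  piece j := (((Pieces.ring K σ).inf A).piece j).prod (((Pieces.ring K σ).inf B).piece j)
  smul_mem a j n hn := ⟨((Pieces.ring K σ).inf A).smul_mem a j n.1 hn.1,
    ((Pieces.ring K σ).inf B).smul_mem a j n.2 hn.2⟩

lemma ext_prodPieces_subsingleton {A B : Ideal (MvPolynomial σ K)} (i j : ℕ)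
    (hA : Subsingleton (Ext (idealObj A) (Pieces.simple K σ j) i))
    (hB : Subsingleton (Ext (idealObj B) (Pieces.simple K σ j) i)) :
    Subsingleton (Ext (prodPieces A B).obj (Pieces.simple K σ j) i) :=
  ext_subsingleton_middle (Pieces.shortExact (G := (Pieces.ring K σ).inf A) (G' := prodPieces A B)
    (G'' := (Pieces.ring K σ).inf B)
    (LinearMap.inl _ _ _) (LinearMap.snd _ _ _) (fun _ _ hn => ⟨hn, Submodule.zero_mem _⟩)
    (fun _ _ hn => hn.2) (fun _ _ _ h => congrArg Prod.fst h) (fun _ _ _ => rfl)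
    (fun _ n hn h => ⟨n.1, hn.1, Prod.ext rfl h.symm⟩)
    (fun _ n hn => ⟨(0, n), ⟨Submodule.zero_mem _, hn⟩, rfl⟩)) _ i hA hB

lemma shortExact_inf_sup {A B : Ideal (MvPolynomial σ K)}
    (hA : A.IsHomogeneous (homogeneousSubmodule σ K))
    (hB : B.IsHomogeneous (homogeneousSubmodule σ K)) :
    (ShortComplex.mk (Pieces.hom (G := (Pieces.ring K σ).inf (A ⊓ B)) (G' := prodPieces A B)
        (LinearMap.prod LinearMap.id (-LinearMap.id))
        fun _ _ hn => ⟨⟨hn.1, hn.2.1⟩, ⟨Submodule.neg_mem _ hn.1, Submodule.neg_mem _ hn.2.2⟩⟩)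
      (Pieces.hom (G' := (Pieces.ring K σ).inf (A ⊔ B)) (LinearMap.coprod LinearMap.id LinearMap.id)
        fun _ _ hn => ⟨Submodule.add_mem _ hn.1.1 hn.2.1,
          Submodule.add_mem_sup hn.1.2 hn.2.2⟩)
      (by ext i n; exact Subtype.ext (add_neg_cancel _))).ShortExact :=
  Pieces.shortExact _ _ _ _ (fun _ _ _ h => congrArg Prod.fst h) (fun _ _ _ => add_neg_cancel _)
    (fun _ n hn h => by
      have h' : n.1 + n.2 = 0 := h
      have e : n.2 = -n.1 := (neg_eq_of_add_eq_zero_right h').symm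
      refine ⟨n.1, ⟨hn.1.1, hn.1.2, ?_⟩, Prod.ext rfl e.symm⟩
      have := B.neg_mem hn.2.2
      rwa [e, neg_neg] at this)
    (fun j n hn => by
      obtain ⟨a, ha, b, hb, e⟩ := Submodule.mem_sup.1 hn.2
      have hcomp : ∀ {C : Ideal (MvPolynomial σ K)},
          C.IsHomogeneous (homogeneousSubmodule σ K) → ∀ c ∈ C,
            homogeneousComponent j c ∈ ((Pieces.ring K σ).inf C).piece j := fun hC c hc =>
        ⟨homogeneousComponent_mem j c, (mem_iff_homogeneousComponent_mem hC c).1 hc j⟩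
      refine ⟨(homogeneousComponent j a, homogeneousComponent j b),
        ⟨hcomp hA a ha, hcomp hB b hb⟩, ?_⟩
      change homogeneousComponent j a + homogeneousComponent j b = n
      rw [← map_add, e, homogeneousComponent_of_mem hn.1, if_pos rfl])

lemma ext_zero_sup_subsingleton {A B : Ideal (MvPolynomial σ K)}
    (hA : A.IsHomogeneous (homogeneousSubmodule σ K))
    (hB : B.IsHomogeneous (homogeneousSubmodule σ K)) (j : ℕ)
    (hA' : Subsingleton (Ext (idealObj A) (Pieces.simple K σ j) 0))
    (hB' : Subsingleton (Ext (idealObj B) (Pieces.simple K σ j) 0)) :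
    Subsingleton (Ext (idealObj (A ⊔ B)) (Pieces.simple K σ j) 0) :=
  ext_zero_subsingleton_right (shortExact_inf_sup hA hB) _
    (ext_prodPieces_subsingleton 0 j hA' hB')

lemma nonempty_ext_sup_succ {A B : Ideal (MvPolynomial σ K)}
    (hA : A.IsHomogeneous (homogeneousSubmodule σ K))
    (hB : B.IsHomogeneous (homogeneousSubmodule σ K)) (j : ℕ)
    (hA' : ∀ i, Subsingleton (Ext (idealObj A) (Pieces.simple K σ j) i))
    (hB' : ∀ i, Subsingleton (Ext (idealObj B) (Pieces.simple K σ j) i)) (i : ℕ) :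
    Nonempty (Ext (idealObj (A ⊓ B)) (Pieces.simple K σ j) i ≃ₗ[K]
      Ext (idealObj (A ⊔ B)) (Pieces.simple K σ j) (i + 1)) := by
  have hE := fun i => ext_prodPieces_subsingleton i j (hA' i) (hB' i)
  refine ⟨LinearEquiv.ofBijective _ (extConnecting_bijective (k := K)
    (shortExact_inf_sup hA hB) (Pieces.simple K σ j) i ?_ (hE (i + 1)))⟩
  intro x
  obtain rfl : x = 0 := (hE i).elim x 0
  exact Ext.comp_zero _ _ _ _ _

/-- All extension modules of the multiples of `A` by homogeneous polynomials of degree `k`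
vanish in degrees at least `D + k`. -/
def ExtVanish (A : Ideal (MvPolynomial σ K)) (D : ℕ) : Prop :=
  ∀ (p : MvPolynomial σ K) (k : ℕ), p ≠ 0 → p.IsHomogeneous k → ∀ i j, D + k ≤ j →
    Subsingleton (Ext (idealObj (Ideal.span {p} * A)) (Pieces.simple K σ j) i)

/-- In degrees at least `D`, the only nonzero graded Betti number of `A` is the one in
homological degree `e` and internal degree `D`, which is one; similarly for the multiples of `A`
by homogeneous polynomials. -/
def ExtTop (A : Ideal (MvPolynomial σ K)) (D e : ℕ) : Prop :=
  ∀ (p : MvPolynomial σ K) (k : ℕ), p ≠ 0 → p.IsHomogeneous k → ∀ i j, D + k ≤ j →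
    Nonempty (Ext (idealObj (Ideal.span {p} * A)) (Pieces.simple K σ j) i ≃ₗ[K]
      (Fin (if j = D + k ∧ i = e then 1 else 0) → K))

lemma ExtTop.extVanish {A : Ideal (MvPolynomial σ K)} {D e D' : ℕ} (h : ExtTop A D e)
    (hD : D < D') : ExtVanish A D' := fun p k hp hk i j hj => by
  obtain ⟨E⟩ := h p k hp hk i j (by omega)
  rw [if_neg (by omega)] at E
  exact E.toEquiv.subsingleton

lemma extTop_span_singleton {q : MvPolynomial σ K} (hq : q ≠ 0) {D : ℕ}
    (hD : q.IsHomogeneous D) : ExtTop (Ideal.span {q}) D 0 := fun p k hp hk i j _ => by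
  rw [Ideal.span_singleton_mul_span_singleton]
  exact nonempty_ext_principal (mul_ne_zero hp hq) (add_comm k D ▸ hk.mul hD) i j

lemma Ideal.span_singleton_mul_inf {R : Type*} [CommRing R] {p : R} {A B : Ideal R}
    (h : ∀ r, p * r ∈ B → r ∈ B) :
    Ideal.span {p} * A ⊓ B = Ideal.span {p} * (A ⊓ B) := by
  apply le_antisymm
  · rintro _ ⟨h1, h2⟩
    obtain ⟨r, hr, rfl⟩ := Ideal.mem_span_singleton_mul.1 h1
    exact Ideal.mem_span_singleton_mul.2 ⟨r, ⟨hr, h r h2⟩, rfl⟩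
  · exact le_inf (Ideal.mul_mono_right inf_le_left)
      (Ideal.mul_le_right.trans inf_le_right)

lemma Ideal.span_singleton_mul_inf_span_singleton_mul {R : Type*} [CommRing R] [IsDomain R]
    {p : R} (hp : p ≠ 0) (A B : Ideal R) :
    Ideal.span {p} * A ⊓ Ideal.span {p} * B = Ideal.span {p} * (A ⊓ B) := by
  apply le_antisymm
  · rintro _ ⟨h1, h2⟩
    obtain ⟨r, hr, rfl⟩ := Ideal.mem_span_singleton_mul.1 h1
    obtain ⟨s, hs, e⟩ := Ideal.mem_span_singleton_mul.1 h2
    obtain rfl := mul_left_cancel₀ hp e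
    exact Ideal.mem_span_singleton_mul.2 ⟨s, ⟨hr, hs⟩, rfl⟩
  · exact le_inf (Ideal.mul_mono_right inf_le_left) (Ideal.mul_mono_right inf_le_right)

lemma isHomogeneous_span_singleton {p : MvPolynomial σ K} {k : ℕ} (hp : p.IsHomogeneous k) :
    (Ideal.span {p}).IsHomogeneous (homogeneousSubmodule σ K) := by
  apply Ideal.homogeneous_span
  rintro _ rfl
  exact ⟨k, hp⟩

lemma ExtTop.sup {A B C : Ideal (MvPolynomial σ K)} {y z : MvPolynomial σ K} {D e : ℕ}
    (hy : y ≠ 0) (hz : z ≠ 0) (hy' : y.IsHomogeneous 1) (hz' : z.IsHomogeneous 2)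
    (hA : A.IsHomogeneous (homogeneousSubmodule σ K))
    (hB : B.IsHomogeneous (homogeneousSubmodule σ K))
    (hinf : Ideal.span {y} * A ⊓ Ideal.span {z} * B = Ideal.span {y * z} * C)
    (hC : ExtTop C D e) (vA : ExtVanish A (D + 1)) (vB : ExtVanish B (D + 1)) :
    ExtTop (Ideal.span {y} * A ⊔ Ideal.span {z} * B) (D + 3) (e + 1) := by
  intro p k hp hk i j hj
  have h1 : ∀ i, Subsingleton
      (Ext (idealObj (Ideal.span {p * y} * A)) (Pieces.simple K σ j) i) := fun i =>
    vA (p * y) (k + 1) (mul_ne_zero hp hy) (hk.mul hy') i j (by omega)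
  have h2 : ∀ i, Subsingleton
      (Ext (idealObj (Ideal.span {p * z} * B)) (Pieces.simple K σ j) i) := fun i =>
    vB (p * z) (k + 2) (mul_ne_zero hp hz) (hk.mul hz') i j (by omega)
  have h1' := (isHomogeneous_span_singleton (hk.mul hy')).mul hA
  have h2' := (isHomogeneous_span_singleton (hk.mul hz')).mul hB
  have hmul : ∀ (q : MvPolynomial σ K) (C : Ideal (MvPolynomial σ K)),
      Ideal.span {p} * (Ideal.span {q} * C) = Ideal.span {p * q} * C := fun q C => by
    rw [← mul_assoc, Ideal.span_singleton_mul_span_singleton]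
  rw [Ideal.mul_sup, hmul, hmul]
  cases i with
  | zero =>
    have := ext_zero_sup_subsingleton h1' h2' j (h1 0) (h2 0)
    exact nonempty_linearEquiv_fin_zero (if_neg (by omega))
  | succ i =>
    obtain ⟨E⟩ := nonempty_ext_sup_succ h1' h2' j h1 h2 i
    rw [← hmul y, ← hmul z B, Ideal.span_singleton_mul_inf_span_singleton_mul hp, hinf, hmul,
      hmul, hmul] at E
    obtain ⟨E'⟩ := hC (p * (y * z)) (k + (1 + 2)) (mul_ne_zero hp (mul_ne_zero hy hz))
      (hk.mul (hy'.mul hz')) i j (by omega)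
    have : (j = D + (k + (1 + 2)) ∧ i = e) ↔ (j = D + 3 + k ∧ i + 1 = e + 1) := by omega
    rw [if_congr this rfl rfl] at E'
    exact ⟨E.symm.trans E'⟩

end GradedIdeals

section TilingIdeals
open MvPolynomial

attribute [local instance] MvPolynomial.gradedAlgebra

/-- An ideal stable under division by the variable `v`, discarding the terms which are not
divisible by it. -/
def Avoids {σ : Type*} {K : Type*} [CommRing K] (v : σ) (I : Ideal (MvPolynomial σ K)) : Prop :=
  ∀ r ∈ I, r.divMonomial (Finsupp.single v 1) ∈ I

namespace Avoids

variable {σ : Type*} {K : Type*} [CommRing K] {v w : σ} {I J : Ideal (MvPolynomial σ K)}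

lemma top : Avoids v (⊤ : Ideal (MvPolynomial σ K)) := fun _ _ => Submodule.mem_top

lemma inf (hI : Avoids v I) (hJ : Avoids v J) : Avoids v (I ⊓ J) :=
  fun r hr => ⟨hI r hr.1, hJ r hr.2⟩

lemma sup (hI : Avoids v I) (hJ : Avoids v J) : Avoids v (I ⊔ J) := fun r hr => by
  obtain ⟨a, ha, b, hb, rfl⟩ := Submodule.mem_sup.1 hr
  rw [add_divMonomial]
  exact Submodule.add_mem_sup (hI a ha) (hJ b hb)

lemma span_X_mul (hI : Avoids v I) (h : v ≠ w) : Avoids v (Ideal.span {X w} * I) := by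
  intro r hr
  obtain ⟨s, hs, rfl⟩ := Ideal.mem_span_singleton_mul.1 hr
  refine Ideal.mem_span_singleton_mul.2 ⟨_, hI s hs, ?_⟩
  ext m
  have e : w ∈ (Finsupp.single v 1 + m).support ↔ w ∈ m.support := by
    simp [Finsupp.single_eq_of_ne h.symm]
  rw [coeff_divMonomial, coeff_X_mul', coeff_X_mul', if_congr e rfl rfl, coeff_divMonomial]
  split_ifs with hw
  · congr 1
    rw [add_tsub_assoc_of_le]
    rw [Finsupp.single_le_iff]
    exact Nat.one_le_iff_ne_zero.2 (Finsupp.mem_support_iff.1 hw)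
  · rfl

lemma mem_of_X_mul_mem (hI : Avoids v I) {r : MvPolynomial σ K} (h : X v * r ∈ I) : r ∈ I := by
  have := hI _ h
  rwa [X_mul_divMonomial] at this

end Avoids

lemma span_singleton_mul_inf_eq {R : Type*} [CommRing R] {y z : R} {A B : Ideal R}
    (hz : ∀ r, z * r ∈ A → r ∈ A)
    (hy : ∀ r, y * r ∈ Ideal.span {z} * B → r ∈ Ideal.span {z} * B) :
    Ideal.span {y} * A ⊓ Ideal.span {z} * B = Ideal.span {y * z} * (A ⊓ B) := by
  rw [Ideal.span_singleton_mul_inf hy, inf_comm A, Ideal.span_singleton_mul_inf hz,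
    ← mul_assoc, Ideal.span_singleton_mul_span_singleton, inf_comm]

/-- The ideals defined by the recursion satisfied by domino tilings, with the labels of a board
with `n` columns. -/
noncomputable def tilingIdeal (K : Type*) [Field K] (n : ℕ) :
    ℕ → Ideal (MvPolynomial (ℕ ⊕ ℕ) K)
  | 0 => ⊤
  | 1 => Ideal.span {X (Sum.inr 1)}
  | m + 2 => Ideal.span {X (Sum.inr (m + 2))} * tilingIdeal K n (m + 1) ⊔
      Ideal.span {X (Sum.inl (m + 1)) * X (Sum.inl (n + m))} * tilingIdeal K n m

variable {K : Type u} [Field K]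

lemma avoids_tilingIdeal (n : ℕ) (v : ℕ ⊕ ℕ) (m : ℕ) :
    (∀ k < m, v ≠ Sum.inr (k + 1)) →
    (∀ k, k + 1 < m → v ≠ Sum.inl (k + 1) ∧ v ≠ Sum.inl (n + k)) →
      Avoids v (tilingIdeal K n m) := by
  induction m using Nat.twoStepInduction with
  | zero => exact fun _ _ => Avoids.top
  | one =>
    intro h _
    have := (Avoids.top (K := K) (v := v)).span_X_mul (h 0 one_pos)
    rwa [Ideal.mul_top] at this
  | more m h0 h1 =>
    intro h h'
    have e0 := h0 (fun k hk => h k (by omega)) (fun k hk => h' k (by omega))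
    have e1 := h1 (fun k hk => h k (by omega)) (fun k hk => h' k (by omega))
    have h'' := h' m (by omega)
    rw [tilingIdeal, ← Ideal.span_singleton_mul_span_singleton, mul_assoc]
    exact (e1.span_X_mul (h (m + 1) (by omega))).sup
      ((e0.span_X_mul h''.2).span_X_mul h''.1)

lemma isHomogeneous_tilingIdeal (n m : ℕ) :
    (tilingIdeal K n m).IsHomogeneous (homogeneousSubmodule (ℕ ⊕ ℕ) K) := by
  induction m using Nat.twoStepInduction with
  | zero => exact Ideal.IsHomogeneous.top _
  | one => exact isHomogeneous_span_singleton (isHomogeneous_X _ _)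
  | more m h0 h1 =>
    exact ((isHomogeneous_span_singleton (isHomogeneous_X _ _)).mul h1).sup
      ((isHomogeneous_span_singleton ((isHomogeneous_X _ _).mul (isHomogeneous_X _ _))).mul h0)

section Step

variable {n m : ℕ}

lemma mem_of_horizontal_mul_mem (h : m + 2 ≤ n) {r : MvPolynomial (ℕ ⊕ ℕ) K}
    (hr : X (Sum.inl (m + 1)) * X (Sum.inl (n + m)) * r ∈ tilingIdeal K n (m + 1)) :
    r ∈ tilingIdeal K n (m + 1) := by
  rw [mul_assoc] at hr
  refine (avoids_tilingIdeal n (Sum.inl (n + m)) (m + 1) ?_ ?_).mem_of_X_mul_mem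
    ((avoids_tilingIdeal n (Sum.inl (m + 1)) (m + 1) ?_ ?_).mem_of_X_mul_mem hr)
  · exact fun k hk => Sum.inl_ne_inr
  · exact fun k hk => ⟨fun e => by have := Sum.inl_injective e; omega,
      fun e => by have := Sum.inl_injective e; omega⟩
  · exact fun k hk => Sum.inl_ne_inr
  · exact fun k hk => ⟨fun e => by have := Sum.inl_injective e; omega,
      fun e => by have := Sum.inl_injective e; omega⟩

lemma avoids_inr_tilingIdeal {l : ℕ} (hl : l < m) :
    Avoids (Sum.inr m) (tilingIdeal K n l) :=
  avoids_tilingIdeal n _ l (fun k hk e => by have := Sum.inr_injective e; omega)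
    fun k hk => ⟨Sum.inr_ne_inl, Sum.inr_ne_inl⟩

lemma avoids_inr_horizontal_mul {l : ℕ} {A : Ideal (MvPolynomial (ℕ ⊕ ℕ) K)}
    (hA : Avoids (Sum.inr l) A) :
    Avoids (Sum.inr l) (Ideal.span {X (Sum.inl (m + 1)) * X (Sum.inl (n + m))} * A) := by
  rw [← Ideal.span_singleton_mul_span_singleton, mul_assoc]
  exact (hA.span_X_mul Sum.inr_ne_inl).span_X_mul Sum.inr_ne_inl

lemma tilingIdeal_inf_succ (h : m + 2 ≤ n) :
    tilingIdeal K n (m + 2) ⊓ tilingIdeal K n (m + 1) =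
      Ideal.span {X (Sum.inr (m + 2))} * tilingIdeal K n (m + 1) ⊔
      Ideal.span {X (Sum.inl (m + 1)) * X (Sum.inl (n + m))} *
        (tilingIdeal K n (m + 1) ⊓ tilingIdeal K n m) := by
  rw [tilingIdeal, sup_inf_assoc_of_le _ Ideal.mul_le_right,
    Ideal.span_singleton_mul_inf fun _ => mem_of_horizontal_mul_mem h, inf_comm (tilingIdeal K n m)]

lemma vertical_inf_horizontal (h : m + 2 ≤ n) {B : Ideal (MvPolynomial (ℕ ⊕ ℕ) K)}
    (hB : Avoids (Sum.inr (m + 2)) B) :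
    Ideal.span {X (Sum.inr (m + 2))} * tilingIdeal K n (m + 1) ⊓
      Ideal.span {X (Sum.inl (m + 1)) * X (Sum.inl (n + m))} * B =
    Ideal.span {X (Sum.inr (m + 2)) * (X (Sum.inl (m + 1)) * X (Sum.inl (n + m)))} *
      (tilingIdeal K n (m + 1) ⊓ B) :=
  span_singleton_mul_inf_eq (fun _ => mem_of_horizontal_mul_mem h)
    fun _ hr => (avoids_inr_horizontal_mul hB).mem_of_X_mul_mem hr

end Step

theorem extTop_tilingIdeal (n m : ℕ) (h : m + 1 ≤ n) :
    ExtTop (tilingIdeal K n (m + 1)) (3 * m + 1) m ∧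
      ExtTop (tilingIdeal K n (m + 1) ⊓ tilingIdeal K n m) (3 * m + 1) m ∧
      ExtVanish (tilingIdeal K n m) (3 * m + 2) := by
  induction m with
  | zero =>
    have h1 : ExtTop (tilingIdeal K n 1) 1 0 :=
      extTop_span_singleton (X_ne_zero _) (isHomogeneous_X _ _)
    refine ⟨h1, ?_, ?_⟩
    · rwa [zero_add, tilingIdeal, inf_top_eq]
    · have := extTop_span_singleton (K := K) (σ := ℕ ⊕ ℕ) one_ne_zero (isHomogeneous_one _ _)
      rw [Ideal.span_singleton_one] at this
      exact this.extVanish (by omega)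
  | succ m ih =>
    obtain ⟨hI, hJ, hv⟩ := ih (by omega)
    have hI' : ExtVanish (tilingIdeal K n (m + 1)) (3 * m + 2) := hI.extVanish (by omega)
    have hJ' : ExtVanish _ (3 * m + 2) := hJ.extVanish (by omega)
    have hy := isHomogeneous_X K (Sum.inr (m + 2) : ℕ ⊕ ℕ)
    have hz := (isHomogeneous_X K (Sum.inl (m + 1) : ℕ ⊕ ℕ)).mul
      (isHomogeneous_X K (Sum.inl (n + m) : ℕ ⊕ ℕ))
    have hz0 : (X (Sum.inl (m + 1)) * X (Sum.inl (n + m)) : MvPolynomial (ℕ ⊕ ℕ) K) ≠ 0 :=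
      mul_ne_zero (X_ne_zero _) (X_ne_zero _)
    have a1 := avoids_inr_tilingIdeal (K := K) (n := n) (show m + 1 < m + 2 by omega)
    have a0 := avoids_inr_tilingIdeal (K := K) (n := n) (show m < m + 2 by omega)
    have g1 := isHomogeneous_tilingIdeal (K := K) n (m + 1)
    have g0 := isHomogeneous_tilingIdeal (K := K) n m
    refine ⟨?_, ?_, hI.extVanish (by omega)⟩
    · rw [tilingIdeal]
      exact ExtTop.sup (X_ne_zero _) hz0 hy hz g1 g0
        (vertical_inf_horizontal h a0) hJ hI' hv
    · rw [tilingIdeal_inf_succ h]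
      refine ExtTop.sup (X_ne_zero _) hz0 hy hz g1 (g1.inf g0) ?_ hJ hI' hJ'
      rw [vertical_inf_horizontal h (a1.inf a0), ← inf_assoc, inf_idem]

end TilingIdeals

section Tiling

lemma mem_Vert {k : ℕ} {c : ℕ × ℕ} : c ∈ Vert k ↔ c.1 < 2 ∧ c.2 = k := by
  obtain ⟨a, b⟩ := c
  simp only [Vert, Finset.mem_insert, Finset.mem_singleton, Prod.mk.injEq]
  omega

lemma mem_Horiz {i k : ℕ} {c : ℕ × ℕ} : c ∈ Horiz i k ↔ c.1 = i ∧ (c.2 = k ∨ c.2 = k + 1) := by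
  obtain ⟨a, b⟩ := c
  simp only [Horiz, Finset.mem_insert, Finset.mem_singleton, Prod.mk.injEq]
  omega

lemma Vert_injective : Function.Injective Vert := fun k l h => by
  have : ((0, k) : ℕ × ℕ) ∈ Vert l := h ▸ mem_Vert.2 ⟨by omega, rfl⟩
  exact (mem_Vert.1 this).2

lemma Horiz_inj {i k j l : ℕ} (h : Horiz i k = Horiz j l) : i = j ∧ k = l := by
  have h1 : ((i, k) : ℕ × ℕ) ∈ Horiz j l := h ▸ mem_Horiz.2 ⟨rfl, Or.inl rfl⟩
  have h2 : ((i, k + 1) : ℕ × ℕ) ∈ Horiz j l := h ▸ mem_Horiz.2 ⟨rfl, Or.inr rfl⟩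
  have h3 : ((j, l) : ℕ × ℕ) ∈ Horiz i k := h ▸ mem_Horiz.2 ⟨rfl, Or.inl rfl⟩
  rw [mem_Horiz] at h1 h2 h3
  dsimp only at h1 h2 h3
  omega

lemma Horiz_ne_Vert (i k l : ℕ) : Horiz i k ≠ Vert l := fun h => by
  have h1 : ((0, l) : ℕ × ℕ) ∈ Horiz i k := h ▸ mem_Vert.2 ⟨by omega, rfl⟩
  have h2 : ((1, l) : ℕ × ℕ) ∈ Horiz i k := h ▸ mem_Vert.2 ⟨by omega, rfl⟩
  rw [mem_Horiz] at h1 h2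
  dsimp only at h1 h2
  omega

lemma dominoVar_Vert (n k : ℕ) : dominoVar n (Vert k) = Sum.inr (k + 1) := by
  have h : ∃ l, Vert k = Vert l := ⟨k, rfl⟩
  rw [dominoVar, dif_pos h, ← Vert_injective h.choose_spec]

lemma dominoVar_Horiz_zero (n k : ℕ) : dominoVar n (Horiz 0 k) = Sum.inl (k + 1) := by
  have h : ∃ l, Horiz 0 k = Horiz 0 l := ⟨k, rfl⟩
  rw [dominoVar, dif_neg fun ⟨l, h⟩ => Horiz_ne_Vert _ _ _ h, dif_pos h,
    ← (Horiz_inj h.choose_spec).2]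

lemma dominoVar_Horiz_one (n k : ℕ) : dominoVar n (Horiz 1 k) = Sum.inl (n + k) := by
  have h : ∃ l, Horiz 1 k = Horiz 1 l := ⟨k, rfl⟩
  rw [dominoVar, dif_neg fun ⟨l, h⟩ => Horiz_ne_Vert _ _ _ h,
    dif_neg fun ⟨l, h⟩ => one_ne_zero (Horiz_inj h).1, dif_pos h, ← (Horiz_inj h.choose_spec).2]

lemma IsDomino.mem {n : ℕ} {d : Finset (ℕ × ℕ)} (hd : IsDomino n d) {c : ℕ × ℕ} (hc : c ∈ d) :
    c.1 < 2 ∧ c.2 < n := by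
  obtain ⟨k, hk, rfl⟩ | ⟨i, hi, k, hk, rfl⟩ := hd
  · rw [mem_Vert] at hc
    omega
  · rw [mem_Horiz] at hc
    omega

lemma IsDomino.mono {n m : ℕ} (h : n ≤ m) {d : Finset (ℕ × ℕ)} (hd : IsDomino n d) :
    IsDomino m d := by
  obtain ⟨k, hk, rfl⟩ | ⟨i, hi, k, hk, rfl⟩ := hd
  · exact Or.inl ⟨k, by omega, rfl⟩
  · exact Or.inr ⟨i, hi, k, by omega, rfl⟩

/-- A domino lying in the first columns of a board is a domino of the smaller board. -/
lemma IsDomino.of_forall_lt {n m : ℕ} {d : Finset (ℕ × ℕ)} (hd : IsDomino n d)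
    (h : ∀ c ∈ d, c.2 < m) : IsDomino m d := by
  obtain ⟨k, -, rfl⟩ | ⟨i, hi, k, -, rfl⟩ := hd
  · exact Or.inl ⟨k, h (0, k) (mem_Vert.2 ⟨two_pos, rfl⟩), rfl⟩
  · exact Or.inr ⟨i, hi, k, h (i, k + 1) (mem_Horiz.2 ⟨rfl, Or.inr rfl⟩), rfl⟩

namespace IsTiling

variable {n m : ℕ} {T S : Finset (Finset (ℕ × ℕ))}

/-- Tiling the columns from `m` to `n` by `S` completes tilings of the first `m` columns. -/
lemma union (hT : IsTiling m T) (hmn : m ≤ n) (hS : ∀ d ∈ S, IsDomino n d)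
    (hcov : ∀ c : ℕ × ℕ, (c.1 < 2 ∧ m ≤ c.2 ∧ c.2 < n) ↔ ∃ d ∈ S, c ∈ d)
    (hdisj : ∀ d ∈ S, ∀ e ∈ S, d ≠ e → Disjoint d e) : IsTiling n (S ∪ T) := by
  have key : ∀ d ∈ S, ∀ e ∈ T, Disjoint d e := fun d hd e he => by
    rw [Finset.disjoint_left]
    intro c hc hc'
    have h1 := (hcov c).2 ⟨d, hd, hc⟩
    have h2 := (hT.2.1 c).2 ⟨e, he, hc'⟩
    omega
  refine ⟨fun d hd => ?_, fun c => ⟨fun hc => ?_, ?_⟩, fun d hd e he hde => ?_⟩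
  · exact (Finset.mem_union.1 hd).elim (hS d) fun h => (hT.1 d h).mono hmn
  · by_cases h : c.2 < m
    · obtain ⟨d, hd, hcd⟩ := (hT.2.1 c).1 ⟨hc.1, h⟩
      exact ⟨d, Finset.mem_union_right _ hd, hcd⟩
    · obtain ⟨d, hd, hcd⟩ := (hcov c).1 ⟨hc.1, by omega, hc.2⟩
      exact ⟨d, Finset.mem_union_left _ hd, hcd⟩
  · rintro ⟨d, hd, hcd⟩
    obtain hd | hd := Finset.mem_union.1 hd
    · exact (hS d hd).mem hcd
    · exact ((hT.1 d hd).mono hmn).mem hcd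
  · obtain hd | hd := Finset.mem_union.1 hd <;> obtain he | he := Finset.mem_union.1 he
    · exact hdisj d hd e he hde
    · exact key d hd e he
    · exact (key e he d hd).symm
    · exact hT.2.2 d hd e he hde

/-- Removing a tiling of the columns from `m` to `n`. -/
lemma sdiff (hT : IsTiling n T) (hST : S ⊆ T) (hmn : m ≤ n)
    (hcov : ∀ c : ℕ × ℕ, (c.1 < 2 ∧ m ≤ c.2 ∧ c.2 < n) ↔ ∃ d ∈ S, c ∈ d) :
    IsTiling m (T \ S) := by
  have key : ∀ d ∈ T \ S, ∀ c ∈ d, c.2 < m := fun d hd c hc => by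
    rw [Finset.mem_sdiff] at hd
    by_contra hlt
    obtain ⟨e, he, hce⟩ := (hcov c).1
      ⟨((hT.1 d hd.1).mem hc).1, by omega, ((hT.1 d hd.1).mem hc).2⟩
    have : d ≠ e := fun h => hd.2 (h ▸ he)
    exact Finset.disjoint_left.1 (hT.2.2 d hd.1 e (hST he) this) hc hce
  have key' : ∀ d ∈ T \ S, IsDomino m d := fun d hd =>
    (hT.1 d (Finset.mem_sdiff.1 hd).1).of_forall_lt (key d hd)
  refine ⟨key', fun c => ⟨fun hc => ?_, ?_⟩, fun d hd e he hde => ?_⟩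
  · obtain ⟨d, hd, hcd⟩ := (hT.2.1 c).1 ⟨hc.1, by omega⟩
    refine ⟨d, Finset.mem_sdiff.2 ⟨hd, fun hd' => ?_⟩, hcd⟩
    have := (hcov c).2 ⟨d, hd', hcd⟩
    omega
  · rintro ⟨d, hd, hcd⟩
    exact (key' d hd).mem hcd
  · exact hT.2.2 d (Finset.mem_sdiff.1 hd).1 e (Finset.mem_sdiff.1 he).1 hde

lemma disjoint (hT : IsTiling m T)
    (hcov : ∀ c : ℕ × ℕ, (c.1 < 2 ∧ m ≤ c.2 ∧ c.2 < n) ↔ ∃ d ∈ S, c ∈ d)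
    (hne : ∀ d ∈ S, d.Nonempty) : Disjoint S T := by
  rw [Finset.disjoint_left]
  intro d hd hd'
  obtain ⟨c, hc⟩ := hne d hd
  have h1 := (hcov c).2 ⟨d, hd, hc⟩
  have h2 := (hT.2.1 c).2 ⟨d, hd', hc⟩
  omega

end IsTiling

lemma vertical_cover (m : ℕ) (c : ℕ × ℕ) :
    (c.1 < 2 ∧ m ≤ c.2 ∧ c.2 < m + 1) ↔
      ∃ d ∈ ({Vert m} : Finset (Finset (ℕ × ℕ))), c ∈ d := by
  simp only [Finset.mem_singleton, exists_eq_left, mem_Vert]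
  omega

lemma horizontal_cover (m : ℕ) (c : ℕ × ℕ) :
    (c.1 < 2 ∧ m ≤ c.2 ∧ c.2 < m + 2) ↔
      ∃ d ∈ ({Horiz 0 m, Horiz 1 m} : Finset (Finset (ℕ × ℕ))), c ∈ d := by
  simp only [Finset.mem_insert, Finset.mem_singleton, exists_eq_or_imp, exists_eq_left, mem_Horiz]
  omega

lemma isTiling_zero_iff {T : Finset (Finset (ℕ × ℕ))} : IsTiling 0 T ↔ T = ∅ := by
  constructor
  · intro h
    refine Finset.eq_empty_of_forall_notMem fun d hd => ?_
    obtain ⟨k, hk, -⟩ | ⟨i, -, k, hk, -⟩ := h.1 d hd <;> omega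
  · rintro rfl
    exact ⟨by simp, by simp, by simp⟩

lemma IsTiling.union_vertical {m : ℕ} {T : Finset (Finset (ℕ × ℕ))} (hT : IsTiling m T) :
    IsTiling (m + 1) ({Vert m} ∪ T) :=
  hT.union (by omega) (fun d hd => Finset.mem_singleton.1 hd ▸ Or.inl ⟨m, by omega, rfl⟩)
    (vertical_cover m) (by simp)

lemma IsTiling.union_horizontal {m : ℕ} {T : Finset (Finset (ℕ × ℕ))} (hT : IsTiling m T) :
    IsTiling (m + 2) ({Horiz 0 m, Horiz 1 m} ∪ T) := by
  have h : Disjoint (Horiz 0 m) (Horiz 1 m) := by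
    rw [Finset.disjoint_left]
    intro c h1 h2
    rw [mem_Horiz] at h1 h2
    omega
  refine hT.union (by omega) ?_ (horizontal_cover m) (by simp [h, h.symm])
  simp only [Finset.mem_insert, Finset.mem_singleton, forall_eq_or_imp, forall_eq]
  exact ⟨Or.inr ⟨0, by omega, m, by omega, rfl⟩, Or.inr ⟨1, by omega, m, by omega, rfl⟩⟩

/-- The last column of a tiled board is covered by a vertical domino or by two horizontal ones. -/
lemma IsTiling.last_column {m : ℕ} {T : Finset (Finset (ℕ × ℕ))} (hT : IsTiling (m + 1) T) :
    Vert m ∈ T ∨ ∃ l, m = l + 1 ∧ Horiz 0 l ∈ T ∧ Horiz 1 l ∈ T := by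
  by_cases hV : Vert m ∈ T
  · exact Or.inl hV
  have key : ∀ i < 2, ∃ l, m = l + 1 ∧ Horiz i l ∈ T := fun i hi => by
    obtain ⟨d, hd, hc⟩ := (hT.2.1 (i, m)).1 ⟨hi, Nat.lt_succ_self m⟩
    obtain ⟨k, hk, rfl⟩ | ⟨j, hj, k, hk, rfl⟩ := hT.1 d hd
    · obtain ⟨-, rfl⟩ := mem_Vert.1 hc
      exact (hV hd).elim
    · rw [mem_Horiz] at hc
      obtain ⟨rfl, h⟩ := hc
      exact ⟨k, by dsimp only at h; omega, hd⟩
  obtain ⟨l, hl, h0⟩ := key 0 two_pos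
  obtain ⟨l', hl', h1⟩ := key 1 one_lt_two
  obtain rfl : l = l' := by omega
  exact Or.inr ⟨l, hl, h0, h1⟩

lemma IsTiling.exists_vertical {m : ℕ} {T : Finset (Finset (ℕ × ℕ))} (hT : IsTiling (m + 1) T)
    (h : Vert m ∈ T) : ∃ T', IsTiling m T' ∧ T = {Vert m} ∪ T' :=
  ⟨_, hT.sdiff (Finset.singleton_subset_iff.2 h) (by omega) (vertical_cover m),
    (Finset.union_sdiff_of_subset (Finset.singleton_subset_iff.2 h)).symm⟩

lemma IsTiling.exists_horizontal {m : ℕ} {T : Finset (Finset (ℕ × ℕ))} (hT : IsTiling (m + 2) T)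
    (h0 : Horiz 0 m ∈ T) (h1 : Horiz 1 m ∈ T) :
    ∃ T', IsTiling m T' ∧ T = {Horiz 0 m, Horiz 1 m} ∪ T' := by
  have h : ({Horiz 0 m, Horiz 1 m} : Finset (Finset (ℕ × ℕ))) ⊆ T := by
    simp [Finset.insert_subset_iff, h0, h1]
  exact ⟨_, hT.sdiff h (by omega) (horizontal_cover m), (Finset.union_sdiff_of_subset h).symm⟩

variable (K : Type*) [Field K]

lemma dominoMonomial_union_vertical (n : ℕ) {m : ℕ} {T : Finset (Finset (ℕ × ℕ))}
    (hT : IsTiling m T) :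
    dominoMonomial K n ({Vert m} ∪ T) =
      MvPolynomial.X (Sum.inr (m + 1)) * dominoMonomial K n T := by
  have : Disjoint {Vert m} T := hT.disjoint (vertical_cover m) fun d hd => by
    rw [Finset.mem_singleton.1 hd]
    exact Finset.insert_nonempty _ _
  rw [dominoMonomial, Finset.prod_union this, Finset.prod_singleton, dominoVar_Vert,
    dominoMonomial]

lemma dominoMonomial_union_horizontal (n : ℕ) {m : ℕ} {T : Finset (Finset (ℕ × ℕ))}
    (hT : IsTiling m T) :
    dominoMonomial K n ({Horiz 0 m, Horiz 1 m} ∪ T) =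
      MvPolynomial.X (Sum.inl (m + 1)) * MvPolynomial.X (Sum.inl (n + m)) *
        dominoMonomial K n T := by
  have : Disjoint {Horiz 0 m, Horiz 1 m} T := hT.disjoint (horizontal_cover m) fun d hd => by
    obtain h | h := Finset.mem_insert.1 hd
    · exact h ▸ Finset.insert_nonempty _ _
    · exact Finset.mem_singleton.1 h ▸ Finset.insert_nonempty _ _
  rw [dominoMonomial, Finset.prod_union this, Finset.prod_pair, dominoVar_Horiz_zero,
    dominoVar_Horiz_one, dominoMonomial]
  exact fun h => zero_ne_one (Horiz_inj h).1

lemma dominoIdealIn_eq_tilingIdeal (n m : ℕ) : dominoIdealIn K n m = tilingIdeal K n m := by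
  have hzero : dominoMonomial K n ∅ = 1 := Finset.prod_empty
  have hmem : ∀ {l T}, IsTiling l T → dominoMonomial K n T ∈ dominoIdealIn K n l :=
    fun hT => Ideal.subset_span ⟨_, hT, rfl⟩
  have hle : ∀ (q : MvPolynomial (ℕ ⊕ ℕ) K) (l : ℕ) (A : Ideal (MvPolynomial (ℕ ⊕ ℕ) K)),
      (∀ T, IsTiling l T → q * dominoMonomial K n T ∈ A) →
        Ideal.span {q} * dominoIdealIn K n l ≤ A := fun q l A h => by
    rw [dominoIdealIn, Ideal.span_mul_span', Ideal.span_le]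
    rintro _ ⟨_, rfl, _, ⟨T, hT, rfl⟩, rfl⟩
    exact h T hT
  have hmul : ∀ {q r : MvPolynomial (ℕ ⊕ ℕ) K} {A : Ideal (MvPolynomial (ℕ ⊕ ℕ) K)}, r ∈ A →
      q * r ∈ Ideal.span {q} * A := fun h => Ideal.mul_mem_mul (Ideal.mem_span_singleton_self _) h
  induction m using Nat.twoStepInduction with
  | zero =>
    rw [tilingIdeal, Ideal.eq_top_iff_one, ← hzero]
    exact hmem (isTiling_zero_iff.2 rfl)
  | one =>
    rw [tilingIdeal]
    apply le_antisymm
    · rw [dominoIdealIn, Ideal.span_le]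
      rintro _ ⟨T, hT, rfl⟩
      obtain h | ⟨l, hl, -⟩ := hT.last_column
      · obtain ⟨T', hT', rfl⟩ := hT.exists_vertical h
        rw [dominoMonomial_union_vertical K n hT']
        exact Ideal.mul_mem_right _ _ (Ideal.mem_span_singleton_self _)
      · omega
    · rw [Ideal.span_singleton_le_iff_mem]
      have h0 : IsTiling 0 ∅ := isTiling_zero_iff.2 rfl
      have := hmem h0.union_vertical
      rwa [dominoMonomial_union_vertical K n h0, hzero, mul_one] at this
  | more m h0 h1 =>
    rw [tilingIdeal, ← h0, ← h1]
    apply le_antisymm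
    · conv_lhs => rw [dominoIdealIn]
      rw [Ideal.span_le]
      rintro _ ⟨T, hT, rfl⟩
      obtain h | ⟨l, hl, hl0, hl1⟩ := hT.last_column
      · obtain ⟨T', hT', rfl⟩ := hT.exists_vertical h
        rw [dominoMonomial_union_vertical K n hT']
        exact Ideal.mem_sup_left (hmul (hmem hT'))
      · obtain rfl : m = l := by omega
        obtain ⟨T', hT', rfl⟩ := hT.exists_horizontal hl0 hl1
        rw [dominoMonomial_union_horizontal K n hT']
        exact Ideal.mem_sup_right (hmul (hmem hT'))
    · refine sup_le (hle _ _ _ fun T hT => ?_) (hle _ _ _ fun T hT => ?_)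
      · rw [← dominoMonomial_union_vertical K n hT]
        exact hmem hT.union_vertical
      · rw [← dominoMonomial_union_horizontal K n hT]
        exact hmem hT.union_horizontal

end Tiling

/-- for n ≥ 3, the top graded Betti number of the domino ideal satisfies
β_{n-1,3n-2}(I_n) = 1. -/
theorem top_betti_domino_ideal (K : Type*) [Field K] :
    ∀ n : ℕ, 3 ≤ n →
      ∀ F : MinimalFreeResolution (dominoIdeal K n),
        F.β (n - 1) (3 * n - 2) = 1 := by
  intro n hn F
  obtain ⟨m, rfl⟩ : ∃ m, n = m + 1 := ⟨n - 1, by omega⟩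
  have hI : dominoIdeal K (m + 1) = Ideal.span {1} * tilingIdeal K (m + 1) (m + 1) := by
    rw [dominoIdeal, dominoIdealIn_eq_tilingIdeal, Ideal.span_singleton_one, Ideal.top_mul]
  obtain ⟨E⟩ := F.nonempty_ext_ideal (m + 1 - 1) (3 * (m + 1) - 2)
  obtain ⟨E'⟩ := (extTop_tilingIdeal (K := K) (m + 1) m le_rfl).1 1 0 one_ne_zero
    (MvPolynomial.isHomogeneous_one _ _) (m + 1 - 1) (3 * (m + 1) - 2) (by omega)
  rw [← hI] at E'
  have := (E.symm.trans E').finrank_eq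
  rwa [Module.finrank_fin_fun, Module.finrank_fin_fun, if_pos (by omega)] at this
end

section
/- If an ideal I in a polynomial ring is splittable as I = V + U via a splitting function, then for all i, j ≥ 0 the graded Betti numbers satisfy β_{i,j}(I) = β_{i,j}(V) + β_{i,j}(U) + β_{i-1,j}(V ∩ U). -/
/-- `I` is a monomial ideal: it is generated by monomials. -/
def IsMonomialIdeal {K : Type*} [Field K] {σ : Type*} (I : Ideal (MvPolynomial σ K)) : Prop :=
  ∃ S : Set (σ →₀ ℕ), I = Ideal.span ((fun a => MvPolynomial.monomial a (1 : K)) '' S)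


namespace MinimalFreeResolution

open MvPolynomial

section GradedFree

variable {K : Type*} [Field K] {σ : Type*} {A B C : Type*}

/-- The degree-`n` component of an element of the graded free module with basis elements
in degrees given by `deg`. -/
noncomputable def degreePart (deg : A → ℕ) (n : ℕ) :
    (A →₀ MvPolynomial σ K) →ₗ[K] (A →₀ MvPolynomial σ K) :=
  Finsupp.lsum K fun a => (Finsupp.lsingle a).comp
    (if deg a ≤ n then homogeneousComponent (n - deg a) else 0)

lemma degreePart_single (deg : A → ℕ) (n : ℕ) (a : A) (r : MvPolynomial σ K) :
    degreePart deg n (Finsupp.single a r) =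
      Finsupp.single a (if deg a ≤ n then homogeneousComponent (n - deg a) r else 0) := by
  simp only [degreePart, Finsupp.lsum_single]
  split_ifs <;> simp

lemma degreePart_apply (deg : A → ℕ) (n : ℕ) (x : A →₀ MvPolynomial σ K) (a : A) :
    degreePart deg n x a = if deg a ≤ n then homogeneousComponent (n - deg a) (x a) else 0 := by
  classical
  induction x using Finsupp.induction_linear with
  | zero => simp
  | add x y hx hy =>
    rw [map_add, Finsupp.add_apply, hx, hy]
    split_ifs <;> simp
  | single b r =>
    rw [degreePart_single, Finsupp.single_apply, Finsupp.single_apply]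
    split_ifs <;> simp_all

/-- A linear map between graded free modules is homogeneous of degree zero. -/
def IsGraded (degA : A → ℕ) (degB : B → ℕ)
    (f : (A →₀ MvPolynomial σ K) →ₗ[MvPolynomial σ K] (B →₀ MvPolynomial σ K)) : Prop :=
  ∀ n x, f (degreePart degA n x) = degreePart degB n (f x)

variable {degA : A → ℕ} {degB : B → ℕ} {degC : C → ℕ}

lemma IsGraded.id : IsGraded degA degA
    (LinearMap.id : (A →₀ MvPolynomial σ K) →ₗ[MvPolynomial σ K] _) := fun _ _ => rfl

lemma IsGraded.comp
    {g : (B →₀ MvPolynomial σ K) →ₗ[MvPolynomial σ K] (C →₀ MvPolynomial σ K)}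
    {f : (A →₀ MvPolynomial σ K) →ₗ[MvPolynomial σ K] (B →₀ MvPolynomial σ K)}
    (hg : IsGraded degB degC g) (hf : IsGraded degA degB f) :
    IsGraded degA degC (g ∘ₗ f) := fun n x => by simp [hf n x, hg n]

lemma IsGraded.add
    {f g : (A →₀ MvPolynomial σ K) →ₗ[MvPolynomial σ K] (B →₀ MvPolynomial σ K)}
    (hf : IsGraded degA degB f) (hg : IsGraded degA degB g) :
    IsGraded degA degB (f + g) := fun n x => by simp [hf n x, hg n x]

lemma IsGraded.neg
    {f : (A →₀ MvPolynomial σ K) →ₗ[MvPolynomial σ K] (B →₀ MvPolynomial σ K)}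
    (hf : IsGraded degA degB f) :
    IsGraded degA degB (-f) := fun n x => by simp [hf n x]

lemma homogeneousComponent_mul_of_isHomogeneous (r : MvPolynomial σ K) {s : MvPolynomial σ K}
    {e : ℕ} (hs : s ∈ homogeneousSubmodule σ K e) (n : ℕ) :
    homogeneousComponent n (r * s) = if e ≤ n then homogeneousComponent (n - e) r * s else 0 := by
  let : GradedAlgebra (homogeneousSubmodule σ K) := MvPolynomial.gradedAlgebra
  have key (p : MvPolynomial σ K) (m : ℕ) :
      (DirectSum.decompose (homogeneousSubmodule σ K) p m : MvPolynomial σ K) =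
        homogeneousComponent m p :=
    decomposition.decompose'_apply p m
  have h := DirectSum.coe_decompose_mul_of_right_mem (homogeneousSubmodule σ K) (a := r) n hs
  simpa only [key] using h

lemma isGraded_of_apply_single
    {f : (A →₀ MvPolynomial σ K) →ₗ[MvPolynomial σ K] (B →₀ MvPolynomial σ K)}
    (h : ∀ a b, f (Finsupp.single a 1) b ∈ homogeneousSubmodule σ K (degA a - degB b))
    (h0 : ∀ a b, degA a < degB b → f (Finsupp.single a 1) b = 0) :
    IsGraded degA degB f := by
  intro n x
  induction x using Finsupp.induction_linear with
  | zero => simp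
  | add x y hx hy => simp only [map_add, hx, hy]
  | single a r =>
    have key : ∀ s : MvPolynomial σ K, f (Finsupp.single a s) = s • f (Finsupp.single a 1) := by
      intro s
      rw [← map_smul, Finsupp.smul_single, smul_eq_mul, mul_one]
    ext1 b
    rw [degreePart_single, key, degreePart_apply, key r, Finsupp.smul_apply, Finsupp.smul_apply,
      smul_eq_mul, smul_eq_mul, homogeneousComponent_mul_of_isHomogeneous r (h a b)]
    rcases lt_or_ge (degA a) (degB b) with hab | hab
    · simp [h0 a b hab]
    · split_ifs with h1 h2 h3 h3
      · congr 3
        omega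
      · omega
      · omega
      · omega
      · simp
      · simp

lemma degreePart_single_one (a : A) :
    degreePart degA (degA a) (Finsupp.single a (1 : MvPolynomial σ K)) = Finsupp.single a 1 := by
  rw [degreePart_single, if_pos le_rfl, Nat.sub_self, homogeneousComponent_zero]
  simp

lemma IsGraded.of_degreePart_apply_single
    {f : (A →₀ MvPolynomial σ K) →ₗ[MvPolynomial σ K] (B →₀ MvPolynomial σ K)}
    (h : ∀ a, degreePart degB (degA a) (f (Finsupp.single a 1)) = f (Finsupp.single a 1)) :
    IsGraded degA degB f := by
  refine isGraded_of_apply_single (fun a b => ?_) (fun a b hab => ?_)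
  · rw [← h a, degreePart_apply]
    split_ifs
    · exact homogeneousComponent_mem _ _
    · exact zero_mem _
  · rw [← h a, degreePart_apply, if_neg (not_le.2 hab)]

lemma exists_linearMap_lift
    (p : (B →₀ MvPolynomial σ K) →ₗ[MvPolynomial σ K] (C →₀ MvPolynomial σ K))
    (f : (A →₀ MvPolynomial σ K) →ₗ[MvPolynomial σ K] (C →₀ MvPolynomial σ K))
    (h : ∀ x, f x ∈ LinearMap.range p) :
    ∃ g : (A →₀ MvPolynomial σ K) →ₗ[MvPolynomial σ K] (B →₀ MvPolynomial σ K),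
      ∀ x, p (g x) = f x := by
  choose y hy using fun a => h (Finsupp.single a 1)
  refine ⟨Finsupp.linearCombination _ y, fun x => ?_⟩
  rw [← LinearMap.comp_apply]
  congr 1
  ext1 a
  ext1
  simp [hy]

lemma exists_isGraded_lift
    {p : (B →₀ MvPolynomial σ K) →ₗ[MvPolynomial σ K] (C →₀ MvPolynomial σ K)}
    {f : (A →₀ MvPolynomial σ K) →ₗ[MvPolynomial σ K] (C →₀ MvPolynomial σ K)}
    (hp : IsGraded degB degC p) (hf : IsGraded degA degC f)
    (h : ∀ x, f x ∈ LinearMap.range p) :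
    ∃ g : (A →₀ MvPolynomial σ K) →ₗ[MvPolynomial σ K] (B →₀ MvPolynomial σ K),
      IsGraded degA degB g ∧ ∀ x, p (g x) = f x := by
  obtain ⟨g, hg⟩ := exists_linearMap_lift p f h
  refine ⟨Finsupp.linearCombination _ fun a => degreePart degB (degA a) (g (Finsupp.single a 1)),
    IsGraded.of_degreePart_apply_single fun a => ?_, fun x => ?_⟩
  · ext1 b
    simp only [Finsupp.linearCombination_single, one_smul, degreePart_apply]
    split_ifs
    · rw [homogeneousComponent_of_mem (homogeneousComponent_mem _ _), if_pos rfl]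
    · rfl
  · rw [← LinearMap.comp_apply]
    congr 1
    ext1 a
    ext1
    simp [hp _ _, hg, ← hf _ _, degreePart_single_one]

/-- The submodule `𝔪F` of a free module `F`, with `𝔪` the irrelevant ideal. -/
def irrelevantSubmodule (K σ A : Type*) [Field K] :
    Submodule (MvPolynomial σ K) (A →₀ MvPolynomial σ K) where
  carrier := {x | ∀ a, constantCoeff (x a) = 0}
  zero_mem' := by simp
  add_mem' := fun hx hy a => by simp [hx a, hy a]
  smul_mem' := fun r x hx a => by simp [hx a]

lemma apply_mem_irrelevantSubmodule
    (f : (A →₀ MvPolynomial σ K) →ₗ[MvPolynomial σ K] (B →₀ MvPolynomial σ K))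
    {x : A →₀ MvPolynomial σ K} (hx : x ∈ irrelevantSubmodule K σ A) :
    f x ∈ irrelevantSubmodule K σ B := by
  rw [← Finsupp.sum_single x, Finsupp.sum, map_sum]
  refine Submodule.sum_mem _ fun a _ b => ?_
  have : f (Finsupp.single a (x a)) = x a • f (Finsupp.single a 1) := by
    rw [← map_smul, Finsupp.smul_single, smul_eq_mul, mul_one]
  simp [this, hx a]

lemma apply_mem_of_single
    (f : (A →₀ MvPolynomial σ K) →ₗ[MvPolynomial σ K] (B →₀ MvPolynomial σ K))
    {N : Submodule (MvPolynomial σ K) (B →₀ MvPolynomial σ K)}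
    (h : ∀ a, f (Finsupp.single a 1) ∈ N) (x : A →₀ MvPolynomial σ K) : f x ∈ N := by
  rw [← Finsupp.sum_single x, Finsupp.sum, map_sum]
  refine Submodule.sum_mem _ fun a _ => ?_
  have : f (Finsupp.single a (x a)) = x a • f (Finsupp.single a 1) := by
    rw [← map_smul, Finsupp.smul_single, smul_eq_mul, mul_one]
  rw [this]
  exact Submodule.smul_mem _ _ (h a)

end GradedFree

lemma exists_dependent_seq {X : ℕ → Type*} (P : ∀ i, X i → Prop) (Q : ∀ i, X i → X (i + 1) → Prop)
    (x₀ : X 0) (h₀ : P 0 x₀) (h : ∀ i x, P i x → ∃ y, P (i + 1) y ∧ Q i x y) :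
    ∃ s : ∀ i, X i, s 0 = x₀ ∧ (∀ i, P i (s i)) ∧ ∀ i, Q i (s i) (s (i + 1)) := by
  choose g hg using h
  let t : ∀ i, {x : X i // P i x} := fun i =>
    Nat.rec ⟨x₀, h₀⟩ (fun i x => ⟨g i x.1 x.2, (hg i x.1 x.2).1⟩) i
  exact ⟨fun i => (t i).1, rfl, fun i => (t i).2, fun i => (hg i (t i).1 (t i).2).2⟩

/-- A complex `⋯ → F₂ → F₁ → F₀` of graded free modules over a polynomial ring. -/
structure GradedComplex.{v, u₁, u₂} (K : Type u₁) (σ : Type u₂) [Field K] where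
  basis : ℕ → Type v
  deg : ∀ i, basis i → ℕ
  d : ∀ i, (basis (i + 1) →₀ MvPolynomial σ K) →ₗ[MvPolynomial σ K] (basis i →₀ MvPolynomial σ K)
  d_d : ∀ i x, d i (d (i + 1) x) = 0
  d_graded : ∀ i, IsGraded (deg (i + 1)) (deg i) (d i)

namespace GradedComplex

variable {K σ : Type*} [Field K]

/-- The `i`-th free module of a graded complex. -/
abbrev X (F : GradedComplex K σ) (i : ℕ) := F.basis i →₀ MvPolynomial σ K

/-- Exactness at all positive spots. -/
def Exact (F : GradedComplex K σ) : Prop :=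
  ∀ i x, F.d i x = 0 → x ∈ LinearMap.range (F.d (i + 1))

/-- Minimality of all differentials except possibly the one into the zeroth spot. -/
def Minimal (F : GradedComplex K σ) : Prop :=
  ∀ i x, F.d (i + 1) x ∈ irrelevantSubmodule K σ (F.basis (i + 1))

lemma exists_chainMap (F G : GradedComplex K σ) (hG : G.Exact)
    (a : F.X 0 →ₗ[MvPolynomial σ K] G.X 0) (ha : IsGraded (F.deg 0) (G.deg 0) a)
    (hr : ∀ x, a (F.d 0 x) ∈ LinearMap.range (G.d 0)) :
    ∃ α : ∀ i, F.X i →ₗ[MvPolynomial σ K] G.X i, α 0 = a ∧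
      (∀ i, IsGraded (F.deg i) (G.deg i) (α i)) ∧
      ∀ i x, G.d i (α (i + 1) x) = α i (F.d i x) := by
  obtain ⟨α, h0, h1, h2⟩ := exists_dependent_seq
    (X := fun i => F.X i →ₗ[MvPolynomial σ K] G.X i)
    (fun i f => IsGraded (F.deg i) (G.deg i) f ∧ ∀ x, f (F.d i x) ∈ LinearMap.range (G.d i))
    (fun i f g => ∀ x, G.d i (g x) = f (F.d i x)) a ⟨ha, hr⟩ (by
      rintro i f ⟨hf, hfr⟩
      obtain ⟨g, hg, hgf⟩ := exists_isGraded_lift (G.d_graded i) (hf.comp (F.d_graded i)) hfr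
      refine ⟨g, ⟨hg, fun x => hG i _ ?_⟩, hgf⟩
      rw [hgf, LinearMap.comp_apply, F.d_d, map_zero])
  exact ⟨α, h0, fun i => (h1 i).1, h2⟩

lemma mem_irrelevantSubmodule_of_chainMap (F : GradedComplex K σ) (hF : F.Exact)
    (hmin : F.Minimal) (γ : ∀ i, F.X i →ₗ[MvPolynomial σ K] F.X i) (h0 : γ 0 = 0)
    (hγ : ∀ i x, F.d i (γ (i + 1) x) = γ i (F.d i x)) (i : ℕ) (x : F.X i) :
    γ i x ∈ irrelevantSubmodule K σ (F.basis i) := by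
  obtain ⟨s, hs0, -, hs⟩ := exists_dependent_seq
    (X := fun i => F.X i →ₗ[MvPolynomial σ K] F.X (i + 1))
    (fun i h => ∀ x, F.d i (h (F.d i x)) = γ i (F.d i x))
    (fun i h h' => ∀ x, F.d (i + 1) (h' x) = γ (i + 1) x - h (F.d i x)) 0 (by simp [h0]) (by
      intro i h hh
      obtain ⟨h', hh'⟩ := exists_linearMap_lift (F.d (i + 1)) (γ (i + 1) - h ∘ₗ F.d i)
        (fun x => hF i _ (by simp [hh, hγ]))
      exact ⟨h', fun x => by simp [hh', F.d_d], fun x => hh' x⟩)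
  cases i with
  | zero => simp [h0]
  | succ i =>
    have h1 : γ (i + 1) x = F.d (i + 1) (s (i + 1) x) + s i (F.d i x) := by simp [hs]
    rw [h1]
    refine Submodule.add_mem _ (hmin i _) ?_
    cases i with
    | zero => simp [hs0]
    | succ i => exact apply_mem_irrelevantSubmodule _ (hmin i _)

/-- The constant polynomials on a homogeneous stratum of the basis, as elements of a graded
free module. -/
noncomputable def constants (F : GradedComplex K σ) (i j : ℕ) :
    ({b : F.basis i // F.deg i b = j} →₀ K) →ₗ[K] F.X i :=
  Finsupp.lsum K fun b => (Finsupp.lsingle b.1).comp (Algebra.linearMap K (MvPolynomial σ K))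

lemma constants_apply (F : GradedComplex K σ) (i j : ℕ)
    (v : {b : F.basis i // F.deg i b = j} →₀ K) (b : {b : F.basis i // F.deg i b = j}) :
    F.constants i j v b.1 = C (v b) := by
  classical
  induction v using Finsupp.induction_linear with
  | zero => simp
  | add x y hx hy => simp [hx, hy]
  | single a r =>
    simp only [constants, Finsupp.lsum_single, LinearMap.comp_apply, Finsupp.lsingle_apply,
      Finsupp.single_apply, Algebra.linearMap_apply, algebraMap_eq, Subtype.ext_iff]
    split_ifs <;> simp

lemma degreePart_constants (F : GradedComplex K σ) (i j : ℕ)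
    (v : {b : F.basis i // F.deg i b = j} →₀ K) :
    degreePart (F.deg i) j (F.constants i j v) = F.constants i j v := by
  induction v using Finsupp.induction_linear with
  | zero => simp
  | add x y hx hy => simp [hx, hy]
  | single a r =>
    have : F.deg i a.1 = j := a.2
    simp [constants, degreePart_single, this, homogeneousComponent_zero]

lemma card_le_card (F G : GradedComplex K σ) (hF : F.Exact) (hG : G.Exact) (hmin : F.Minimal)
    (a : F.X 0 →ₗ[MvPolynomial σ K] G.X 0) (ha : IsGraded (F.deg 0) (G.deg 0) a)
    (har : ∀ x, a (F.d 0 x) ∈ LinearMap.range (G.d 0))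
    (b : G.X 0 →ₗ[MvPolynomial σ K] F.X 0) (hb : IsGraded (G.deg 0) (F.deg 0) b)
    (hbr : ∀ x, b (G.d 0 x) ∈ LinearMap.range (F.d 0))
    (hba : ∀ x, b (a x) = x) (i j : ℕ)
    [Finite {c : F.basis i // F.deg i c = j}] [Finite {c : G.basis i // G.deg i c = j}] :
    Nat.card {c : F.basis i // F.deg i c = j} ≤ Nat.card {c : G.basis i // G.deg i c = j} := by
  obtain ⟨α, hα0, hα, hαd⟩ := exists_chainMap F G hG a ha har
  obtain ⟨β, hβ0, hβ, hβd⟩ := exists_chainMap G F hF b hb hbr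
  have hγ := mem_irrelevantSubmodule_of_chainMap F hF hmin
    (fun i => β i ∘ₗ α i - LinearMap.id) (by ext1; ext1; simp [hα0, hβ0, hba])
    (by simp [hβd, hαd]) i
  have := Fintype.ofFinite {c : F.basis i // F.deg i c = j}
  have := Fintype.ofFinite {c : G.basis i // G.deg i c = j}
  let L : ({c : F.basis i // F.deg i c = j} →₀ K) →ₗ[K] ({c : G.basis i // G.deg i c = j} → K) :=
    { toFun := fun v c => coeff 0 (α i (F.constants i j v) c.1)
      map_add' := fun v w => by ext; simp
      map_smul' := fun r v => by
        ext c
        have : F.constants i j (r • v) = (C r : MvPolynomial σ K) • F.constants i j v := by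
          rw [map_smul]
          ext1
          simp [smul_eq_C_mul]
        simp [this] }
  have hL : Function.Injective L := by
    rw [injective_iff_map_eq_zero]
    intro v hv
    have hm : α i (F.constants i j v) ∈ irrelevantSubmodule K σ (G.basis i) := by
      intro c
      rw [constantCoeff_eq]
      by_cases hc : G.deg i c = j
      · exact congrFun hv ⟨c, hc⟩
      · rw [← degreePart_constants, hα i, degreePart_apply]
        split_ifs with h
        · rw [coeff_homogeneousComponent, if_neg]
          simp only [map_zero]
          omega
        · simp
    have h1 := Submodule.sub_mem _ (apply_mem_irrelevantSubmodule (β i) hm)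
      (hγ (F.constants i j v))
    ext c
    have h2 := h1 c.1
    simpa [constants_apply] using h2
  simpa [Nat.card_eq_fintype_card] using LinearMap.finrank_le_finrank_of_injective hL

section Bar

/-- The exponent of the least common multiple of a tuple of monomials. -/
noncomputable def lcmExponent {S : Set (σ →₀ ℕ)} {p : ℕ} (w : Fin p → S) : σ →₀ ℕ :=
  Finset.univ.sup fun k => (w k : σ →₀ ℕ)

lemma lcmExponent_zero {S : Set (σ →₀ ℕ)} (w : Fin 0 → S) : lcmExponent w = 0 := rfl

lemma lcmExponent_one {S : Set (σ →₀ ℕ)} (w : Fin 1 → S) : lcmExponent w = w 0 := by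
  simp [lcmExponent]

lemma lcmExponent_removeNth_le {S : Set (σ →₀ ℕ)} {p : ℕ} (k : Fin (p + 1))
    (w : Fin (p + 1) → S) : lcmExponent (k.removeNth w) ≤ lcmExponent w :=
  Finset.sup_le fun l _ =>
    Finset.le_sup (f := fun l => (w l : σ →₀ ℕ)) (Finset.mem_univ (k.succAbove l))

lemma lcmExponent_cons {S : Set (σ →₀ ℕ)} {p : ℕ} (u : S) (w : Fin p → S) :
    lcmExponent (Fin.cons u w : Fin (p + 1) → S) = u.1 ⊔ lcmExponent w := by
  refine le_antisymm (Finset.sup_le fun l _ => ?_) (sup_le ?_ (Finset.sup_le fun l _ => ?_))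
  · cases l using Fin.cases with
    | zero => simp
    | succ l =>
      exact le_sup_of_le_right
        (Finset.le_sup (f := fun l => (w l : σ →₀ ℕ)) (Finset.mem_univ l))
  · exact Finset.le_sup (f := fun l => ((Fin.cons u w : Fin (p + 1) → S) l : σ →₀ ℕ))
      (Finset.mem_univ 0)
  · exact Finset.le_sup (f := fun l => ((Fin.cons u w : Fin (p + 1) → S) l : σ →₀ ℕ))
      (Finset.mem_univ l.succ)

variable (K)

/-- The differential of the simplicial chain complex on all tuples in `S`. -/
noncomputable def tupleBoundary (S : Set (σ →₀ ℕ)) (p : ℕ) :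
    ((Fin (p + 1) → S) →₀ MvPolynomial σ K) →ₗ[MvPolynomial σ K]
      ((Fin p → S) →₀ MvPolynomial σ K) :=
  Finsupp.linearCombination _ fun w =>
    ∑ k : Fin (p + 1), Finsupp.single (k.removeNth w) ((-1) ^ (k : ℕ))

/-- The differential of the homogenized tuple complex, where a tuple has the multidegree
of its least common multiple. -/
noncomputable def barDifferential (S : Set (σ →₀ ℕ)) (p : ℕ) :
    ((Fin (p + 1) → S) →₀ MvPolynomial σ K) →ₗ[MvPolynomial σ K]
      ((Fin p → S) →₀ MvPolynomial σ K) :=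
  Finsupp.linearCombination _ fun w =>
    ∑ k : Fin (p + 1), Finsupp.single (k.removeNth w)
      (monomial (lcmExponent w - lcmExponent (k.removeNth w)) ((-1) ^ (k : ℕ)))

/-- The embedding of the homogenized tuple complex into the tuple complex. -/
noncomputable def barDehomogenize (S : Set (σ →₀ ℕ)) (p : ℕ) :
    ((Fin p → S) →₀ MvPolynomial σ K) →ₗ[MvPolynomial σ K] ((Fin p → S) →₀ MvPolynomial σ K) :=
  Finsupp.linearCombination _ fun w => Finsupp.single w (monomial (lcmExponent w) 1)

variable {K} {S : Set (σ →₀ ℕ)}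

lemma removeNth_succ_cons {p : ℕ} (u : S) (w : Fin (p + 1) → S) (k : Fin (p + 1)) :
    (k.succ).removeNth (Fin.cons u w : Fin (p + 2) → S) =
      (Fin.cons u (k.removeNth w) : Fin (p + 1) → S) :=
  funext (Fin.cases rfl fun _ => by simp [Fin.removeNth])

lemma tupleBoundary_zero_cons (u : S) (z : (Fin 0 → S) →₀ MvPolynomial σ K) :
    tupleBoundary K S 0 (Finsupp.lmapDomain _ (MvPolynomial σ K)
      (fun w => (Fin.cons u w : Fin 1 → S)) z) = z := by
  rw [← LinearMap.comp_apply]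
  conv_rhs => rw [← LinearMap.id_apply (R := MvPolynomial σ K) z]
  congr 1
  ext1 w
  ext1
  simp [tupleBoundary]

lemma tupleBoundary_succ_cons {p : ℕ} (u : S) (z : (Fin (p + 1) → S) →₀ MvPolynomial σ K) :
    tupleBoundary K S (p + 1) (Finsupp.lmapDomain _ (MvPolynomial σ K)
      (fun w => (Fin.cons u w : Fin (p + 2) → S)) z) =
      z - Finsupp.lmapDomain _ (MvPolynomial σ K) (fun w => (Fin.cons u w : Fin (p + 1) → S))
        (tupleBoundary K S p z) := by
  rw [← LinearMap.comp_apply, ← LinearMap.comp_apply]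
  conv_rhs => arg 1; rw [← LinearMap.id_apply (R := MvPolynomial σ K) z]
  rw [← LinearMap.sub_apply]
  congr 1
  ext1 w
  ext1
  simp [tupleBoundary, Fin.sum_univ_succ (n := p + 1), removeNth_succ_cons, pow_succ,
    Finsupp.single_neg, Finset.sum_neg_distrib, sub_eq_add_neg]

lemma tupleBoundary_tupleBoundary (p : ℕ) (z : (Fin (p + 2) → S) →₀ MvPolynomial σ K) :
    tupleBoundary K S p (tupleBoundary K S (p + 1) z) = 0 := by
  induction z using Finsupp.induction_linear with
  | zero => simp
  | add x y hx hy => simp [hx, hy]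
  | single w r =>
    have hw : Finsupp.single w r = Finsupp.lmapDomain _ (MvPolynomial σ K)
        (fun v => (Fin.cons (w 0) v : Fin (p + 2) → S)) (Finsupp.single (Fin.tail w) r) := by
      simp [Fin.cons_self_tail]
    rw [hw, tupleBoundary_succ_cons, map_sub]
    induction p with
    | zero => rw [tupleBoundary_zero_cons, sub_self]
    | succ p ih =>
      have h := ih (Fin.tail w) (by simp [Fin.cons_self_tail])
      rw [tupleBoundary_succ_cons, sub_sub_cancel]
      have h' : Finsupp.single (Fin.tail w) r = Finsupp.lmapDomain _ (MvPolynomial σ K)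
          (fun v => (Fin.cons (Fin.tail w 0) v : Fin (p + 2) → S))
          (Finsupp.single (Fin.tail (Fin.tail w)) r) := by
        simp [Fin.cons_self_tail]
      conv_lhs => rw [h', tupleBoundary_succ_cons, map_sub, h]
      simp

lemma barDehomogenize_apply (p : ℕ) (x : (Fin p → S) →₀ MvPolynomial σ K) (w : Fin p → S) :
    barDehomogenize K S p x w = x w * monomial (lcmExponent w) 1 := by
  classical
  induction x using Finsupp.induction_linear with
  | zero => simp
  | add x y hx hy => simp [hx, hy, add_mul]
  | single v r =>
    simp only [barDehomogenize, Finsupp.linearCombination_single, Finsupp.smul_single,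
      smul_eq_mul, Finsupp.single_apply]
    split_ifs with h
    · rw [h]
    · simp

lemma barDehomogenize_injective (p : ℕ) : Function.Injective (barDehomogenize K S p) := by
  intro x y hxy
  ext1 w
  have := DFunLike.congr_fun hxy w
  rw [barDehomogenize_apply, barDehomogenize_apply] at this
  exact mul_right_cancel₀ (by simp) this

lemma barDehomogenize_barDifferential (p : ℕ) (x : (Fin (p + 1) → S) →₀ MvPolynomial σ K) :
    barDehomogenize K S p (barDifferential K S p x) =
      tupleBoundary K S p (barDehomogenize K S (p + 1) x) := by
  rw [← LinearMap.comp_apply, ← LinearMap.comp_apply]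
  congr 1
  ext1 w
  ext1
  simp only [LinearMap.comp_apply, Finsupp.lsingle_apply, barDifferential, barDehomogenize,
    tupleBoundary, Finsupp.linearCombination_single, one_smul, map_sum, Finset.smul_sum,
    Finsupp.smul_single, smul_eq_mul, monomial_mul, mul_one]
  refine Finset.sum_congr rfl fun k _ => ?_
  rw [tsub_add_cancel_of_le (lcmExponent_removeNth_le k w)]
  congr 1
  rw [mul_comm, ← C_1, ← C_neg, ← C_pow, C_mul_monomial, mul_one]

variable (K S)

/-- The homogenized complex of all tuples of elements of a set of monomials `S`, a
nonminimal free resolution of the ideal spanned by `S`. -/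
noncomputable def bar : GradedComplex K σ where
  basis p := Fin p → S
  deg _ w := (lcmExponent w).degree
  d p := barDifferential K S p
  d_d p x := by
    apply barDehomogenize_injective
    rw [barDehomogenize_barDifferential, barDehomogenize_barDifferential,
      tupleBoundary_tupleBoundary, map_zero]
  d_graded p := by
    refine IsGraded.of_degreePart_apply_single fun w => ?_
    simp only [barDifferential, Finsupp.linearCombination_single, one_smul, map_sum]
    refine Finset.sum_congr rfl fun k _ => ?_
    have hle := lcmExponent_removeNth_le k w
    have hdeg : (lcmExponent w - lcmExponent (k.removeNth w)).degree =
        (lcmExponent w).degree - (lcmExponent (k.removeNth w)).degree := by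
      rw [eq_tsub_iff_add_eq_of_le (Finsupp.degree_mono hle), ← map_add,
        tsub_add_cancel_of_le hle]
    rw [degreePart_single, if_pos (Finsupp.degree_mono hle),
      homogeneousComponent_of_mem (isHomogeneous_monomial _ hdeg), if_pos rfl]

/-- The cone of a tuple with a chosen vertex of `S` dividing the monomial with exponent `a`. -/
noncomputable def barConeTerm {p : ℕ} (a : σ →₀ ℕ) (w : Fin p → S) :
    (Fin (p + 1) → S) →₀ MvPolynomial σ K :=
  open Classical in
  if h : ∃ u : S, u.1 ≤ a then
    Finsupp.single (Fin.cons h.choose w)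
      (monomial (a - lcmExponent (Fin.cons h.choose w : Fin (p + 1) → S)) 1)
  else 0

/-- The contracting homotopy of the homogenized tuple complex. -/
noncomputable def barHomotopy (p : ℕ) :
    ((Fin p → S) →₀ MvPolynomial σ K) →ₗ[K] ((Fin (p + 1) → S) →₀ MvPolynomial σ K) :=
  Finsupp.lsum K fun w => (basisMonomials σ K).constr K fun c =>
    barConeTerm K S (c + lcmExponent w) w

variable {K S}

lemma barHomotopy_single {p : ℕ} (w : Fin p → S) (c : σ →₀ ℕ) (r : K) :
    barHomotopy K S p (Finsupp.single w (monomial c r)) =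
      r • barConeTerm K S (c + lcmExponent w) w := by
  have h : monomial c r = r • basisMonomials σ K c := by
    simp [smul_monomial]
  rw [barHomotopy, Finsupp.lsum_single, h, map_smul, Module.Basis.constr_basis]

lemma barDifferential_barHomotopy (p : ℕ) (x : (Fin (p + 1) → S) →₀ MvPolynomial σ K) :
    barDifferential K S (p + 1) (barHomotopy K S (p + 1) x) +
      barHomotopy K S p (barDifferential K S p x) = x := by
  induction x using Finsupp.induction_linear with
  | zero => simp
  | add x y hx hy =>
    conv_rhs => rw [← hx, ← hy]
    simp only [map_add]
    abel
  | single w r =>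
    induction r using MvPolynomial.induction_on' with
    | add p q hp hq =>
      rw [Finsupp.single_add]
      conv_rhs => rw [← hp, ← hq]
      simp only [map_add]
      abel
    | monomial c r =>
      have hex : ∃ u : S, u.1 ≤ c + lcmExponent w :=
        ⟨w 0, le_add_left (Finset.le_sup (f := fun l => (w l : σ →₀ ℕ)) (Finset.mem_univ 0))⟩
      have hle {q : ℕ} (v : Fin q → S) (hv : lcmExponent v ≤ lcmExponent w) :
          lcmExponent (Fin.cons hex.choose v : Fin (q + 1) → S) ≤ c + lcmExponent w := by
        rw [lcmExponent_cons]
        exact sup_le hex.choose_spec (le_add_left hv)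
      have hd : barDifferential K S p (Finsupp.single w (monomial c r)) =
          ∑ k : Fin (p + 1), Finsupp.single (k.removeNth w)
            (monomial (c + (lcmExponent w - lcmExponent (k.removeNth w)))
              (r * (-1) ^ (k : ℕ))) := by
        simp [barDifferential, Finset.smul_sum, monomial_mul]
      have hh (k : Fin (p + 1)) : c + (lcmExponent w - lcmExponent (k.removeNth w)) +
          lcmExponent (k.removeNth w) = c + lcmExponent w := by
        rw [add_assoc, tsub_add_cancel_of_le (lcmExponent_removeNth_le k w)]
      have hd' : barDifferential K S (p + 1) (barHomotopy K S (p + 1)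
          (Finsupp.single w (monomial c r))) = Finsupp.single w (monomial c r) +
          ∑ k : Fin (p + 1), Finsupp.single (Fin.cons hex.choose (k.removeNth w))
            (monomial (c + lcmExponent w -
              lcmExponent (Fin.cons hex.choose (k.removeNth w) : Fin (p + 1) → S))
              (- (r * (-1) ^ (k : ℕ)))) := by
        have h0 := hle w le_rfl
        have hrem (k : Fin (p + 2)) := tsub_add_tsub_cancel h0 (lcmExponent_removeNth_le k
          (Fin.cons hex.choose w : Fin (p + 2) → S))
        rw [barHomotopy_single, barConeTerm, dif_pos hex, Finsupp.smul_single, smul_monomial,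
          barDifferential, Finsupp.linearCombination_single, Finset.smul_sum]
        simp only [Finsupp.smul_single, smul_eq_mul, monomial_mul, hrem, mul_one]
        rw [Fin.sum_univ_succ]
        simp [removeNth_succ_cons, pow_succ]
      rw [hd', hd, map_sum]
      simp only [barHomotopy_single, hh]
      rw [add_assoc, ← Finset.sum_add_distrib, Finset.sum_eq_zero, add_zero]
      intro k _
      rw [barConeTerm, dif_pos hex, Finsupp.smul_single, ← Finsupp.single_add, smul_monomial,
        ← map_add]
      simp

variable (K S)

lemma bar_exact : (bar K S).Exact := fun p x hx =>
  ⟨barHomotopy K S (p + 1) x, by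
    have h := barDifferential_barHomotopy p x
    have hx' : barDifferential K S p x = 0 := hx
    rwa [hx', map_zero, add_zero] at h⟩

lemma single_mem_range_bar_d_zero (r : MvPolynomial σ K)
    (hr : r ∈ Ideal.span ((fun a => monomial a (1 : K)) '' S)) (w : Fin 0 → S) :
    Finsupp.single w r ∈ LinearMap.range ((bar K S).d 0) := by
  have h : Ideal.span ((fun a => monomial a (1 : K)) '' S) ≤
      (LinearMap.range ((bar K S).d 0)).comap (Finsupp.lsingle w) := by
    rw [Ideal.span_le]
    rintro _ ⟨u, hu, rfl⟩
    have h' : barDifferential K S 0 (Finsupp.single (fun _ => ⟨u, hu⟩) 1) =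
        Finsupp.single w (monomial u 1) := by
      rw [barDifferential, Finsupp.linearCombination_single]
      simp [lcmExponent_zero, lcmExponent_one, Subsingleton.elim _ w]
    exact ⟨_, h'⟩
  exact h hr

/-- The map of homogenized tuple complexes induced by a map of generators `f`. -/
noncomputable def barMap {T : Set (σ →₀ ℕ)} (f : S → T) (p : ℕ) :
    ((Fin p → S) →₀ MvPolynomial σ K) →ₗ[MvPolynomial σ K] ((Fin p → T) →₀ MvPolynomial σ K) :=
  Finsupp.linearCombination _ fun w : Fin p → S =>
    Finsupp.single (f ∘ w : Fin p → T) (monomial (lcmExponent w - lcmExponent (f ∘ w)) 1)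

variable {K S} {T : Set (σ →₀ ℕ)} {f : S → T}

lemma lcmExponent_comp_le (hf : ∀ s : S, (f s).1 ≤ s) {p : ℕ} (w : Fin p → S) :
    lcmExponent (f ∘ w) ≤ lcmExponent w :=
  Finset.sup_mono_fun fun _ _ => hf _

lemma barMap_d (hf : ∀ s : S, (f s).1 ≤ s) (p : ℕ) (x : (Fin (p + 1) → S) →₀ MvPolynomial σ K) :
    barDifferential K T p (barMap K S f (p + 1) x) = barMap K S f p (barDifferential K S p x) := by
  rw [← LinearMap.comp_apply, ← LinearMap.comp_apply]
  congr 1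
  ext1 w
  ext1
  have h1 (k : Fin (p + 1)) := tsub_add_tsub_cancel (lcmExponent_comp_le hf w)
    (lcmExponent_removeNth_le k (f ∘ w))
  have h2 (k : Fin (p + 1)) := tsub_add_tsub_cancel (lcmExponent_removeNth_le k w)
    (lcmExponent_comp_le hf (k.removeNth w))
  have h3 (k : Fin (p + 1)) : f ∘ k.removeNth w = k.removeNth (f ∘ w) := rfl
  simp only [h3] at h2
  simp [barDifferential, barMap, Finset.smul_sum, monomial_mul, h1, h2, h3]

lemma barMap_graded (hf : ∀ s : S, (f s).1 ≤ s) (p : ℕ) :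
    IsGraded (fun w : Fin p → S => (lcmExponent w).degree)
      (fun w : Fin p → T => (lcmExponent w).degree) (barMap K S f p) := by
  refine IsGraded.of_degreePart_apply_single fun w => ?_
  have hle := lcmExponent_comp_le hf w
  have hdeg : (lcmExponent w - lcmExponent (f ∘ w)).degree =
      (lcmExponent w).degree - (lcmExponent (f ∘ w)).degree := by
    rw [eq_tsub_iff_add_eq_of_le (Finsupp.degree_mono hle), ← map_add,
      tsub_add_cancel_of_le hle]
  rw [barMap, Finsupp.linearCombination_single, one_smul, degreePart_single,
    if_pos (Finsupp.degree_mono hle),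
    homogeneousComponent_of_mem (isHomogeneous_monomial _ hdeg), if_pos rfl]

lemma barMap_mem_irrelevantSubmodule
    (hf : ∀ (p : ℕ) (w : Fin (p + 1) → S), lcmExponent (f ∘ w) < lcmExponent w)
    (p : ℕ) (x : (Fin (p + 1) → S) →₀ MvPolynomial σ K) :
    barMap K S f (p + 1) x ∈ irrelevantSubmodule K σ (Fin (p + 1) → T) := by
  classical
  refine apply_mem_of_single _ (fun w v => ?_) x
  rw [barMap, Finsupp.linearCombination_single, one_smul, Finsupp.single_apply]
  split_ifs
  · rw [constantCoeff_monomial, if_neg]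
    intro h
    exact (hf p w).not_ge (tsub_eq_zero_iff_le.1 h)
  · simp

end Bar

section Cone

variable {A B : Type*}

/-- The inclusion of the first summand of a free module. -/
noncomputable def sumInl (K σ A B : Type*) [Field K] :
    (A →₀ MvPolynomial σ K) →ₗ[MvPolynomial σ K] (A ⊕ B →₀ MvPolynomial σ K) :=
  (Finsupp.sumFinsuppLEquivProdFinsupp _).symm.toLinearMap ∘ₗ LinearMap.inl _ _ _

/-- The inclusion of the second summand of a free module. -/
noncomputable def sumInr (K σ A B : Type*) [Field K] :
    (B →₀ MvPolynomial σ K) →ₗ[MvPolynomial σ K] (A ⊕ B →₀ MvPolynomial σ K) :=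
  (Finsupp.sumFinsuppLEquivProdFinsupp _).symm.toLinearMap ∘ₗ LinearMap.inr _ _ _

/-- The projection to the first summand of a free module. -/
noncomputable def sumFst (K σ A B : Type*) [Field K] :
    (A ⊕ B →₀ MvPolynomial σ K) →ₗ[MvPolynomial σ K] (A →₀ MvPolynomial σ K) :=
  LinearMap.fst _ _ _ ∘ₗ (Finsupp.sumFinsuppLEquivProdFinsupp _).toLinearMap

/-- The projection to the second summand of a free module. -/
noncomputable def sumSnd (K σ A B : Type*) [Field K] :
    (A ⊕ B →₀ MvPolynomial σ K) →ₗ[MvPolynomial σ K] (B →₀ MvPolynomial σ K) :=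
  LinearMap.snd _ _ _ ∘ₗ (Finsupp.sumFinsuppLEquivProdFinsupp _).toLinearMap

@[simp] lemma sumFst_sumInl (x : A →₀ MvPolynomial σ K) :
    sumFst K σ A B (sumInl K σ A B x) = x := by simp [sumFst, sumInl]

@[simp] lemma sumFst_sumInr (x : B →₀ MvPolynomial σ K) :
    sumFst K σ A B (sumInr K σ A B x) = 0 := by simp [sumFst, sumInr]

@[simp] lemma sumSnd_sumInl (x : A →₀ MvPolynomial σ K) :
    sumSnd K σ A B (sumInl K σ A B x) = 0 := by simp [sumSnd, sumInl]

@[simp] lemma sumSnd_sumInr (x : B →₀ MvPolynomial σ K) :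
    sumSnd K σ A B (sumInr K σ A B x) = x := by simp [sumSnd, sumInr]

lemma sumInl_add_sumInr (x : A ⊕ B →₀ MvPolynomial σ K) :
    sumInl K σ A B (sumFst K σ A B x) + sumInr K σ A B (sumSnd K σ A B x) = x := by
  ext1 c
  cases c <;> simp [sumInl, sumInr, sumFst, sumSnd]

lemma sumInl_graded (degA : A → ℕ) (degB : B → ℕ) :
    IsGraded degA (Sum.elim degA degB) (sumInl K σ A B) := by
  intro n x
  ext1 c
  cases c with
  | inl a =>
    simp only [degreePart_apply, Sum.elim_inl]
    simp [sumInl, degreePart_apply]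
  | inr b => simp [degreePart_apply, sumInl]

lemma sumInr_graded (degA : A → ℕ) (degB : B → ℕ) :
    IsGraded degB (Sum.elim degA degB) (sumInr K σ A B) := by
  intro n x
  ext1 c
  cases c with
  | inl a => simp [degreePart_apply, sumInr]
  | inr b =>
    simp only [degreePart_apply, Sum.elim_inr]
    simp [sumInr, degreePart_apply]

lemma sumFst_apply (x : A ⊕ B →₀ MvPolynomial σ K) (c : A) :
    sumFst K σ A B x c = x (Sum.inl c) := by simp [sumFst]

lemma sumFst_graded (degA : A → ℕ) (degB : B → ℕ) :
    IsGraded (Sum.elim degA degB) degA (sumFst K σ A B) := by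
  intro n x
  ext1 c
  rw [sumFst_apply, degreePart_apply, degreePart_apply, sumFst_apply]
  rfl

lemma sumSnd_apply (x : A ⊕ B →₀ MvPolynomial σ K) (c : B) :
    sumSnd K σ A B x c = x (Sum.inr c) := by simp [sumSnd]

lemma sumSnd_graded (degA : A → ℕ) (degB : B → ℕ) :
    IsGraded (Sum.elim degA degB) degB (sumSnd K σ A B) := by
  intro n x
  ext1 c
  rw [sumSnd_apply, degreePart_apply, degreePart_apply, sumSnd_apply]
  rfl

variable {A' B' C : Type*}

/-- The map `A ⊕ B → C` with components `p` and `q`. -/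
noncomputable def sumDesc
    (p : (A →₀ MvPolynomial σ K) →ₗ[MvPolynomial σ K] (C →₀ MvPolynomial σ K))
    (q : (B →₀ MvPolynomial σ K) →ₗ[MvPolynomial σ K] (C →₀ MvPolynomial σ K)) :
    (A ⊕ B →₀ MvPolynomial σ K) →ₗ[MvPolynomial σ K] (C →₀ MvPolynomial σ K) :=
  p ∘ₗ sumFst K σ A B + q ∘ₗ sumSnd K σ A B

/-- The upper triangular map `A ⊕ B → A' ⊕ B'` with diagonal entries `p`, `r` and remaining
entry `q`. -/
noncomputable def triangularMap
    (p : (A →₀ MvPolynomial σ K) →ₗ[MvPolynomial σ K] (A' →₀ MvPolynomial σ K))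
    (q : (B →₀ MvPolynomial σ K) →ₗ[MvPolynomial σ K] (A' →₀ MvPolynomial σ K))
    (r : (B →₀ MvPolynomial σ K) →ₗ[MvPolynomial σ K] (B' →₀ MvPolynomial σ K)) :
    (A ⊕ B →₀ MvPolynomial σ K) →ₗ[MvPolynomial σ K] (A' ⊕ B' →₀ MvPolynomial σ K) :=
  sumInl K σ A' B' ∘ₗ sumDesc p q + sumInr K σ A' B' ∘ₗ r ∘ₗ sumSnd K σ A B

section Triangular

variable {p : (A →₀ MvPolynomial σ K) →ₗ[MvPolynomial σ K] (A' →₀ MvPolynomial σ K)}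
  {q : (B →₀ MvPolynomial σ K) →ₗ[MvPolynomial σ K] (A' →₀ MvPolynomial σ K)}
  {r : (B →₀ MvPolynomial σ K) →ₗ[MvPolynomial σ K] (B' →₀ MvPolynomial σ K)}

lemma sumDesc_apply (x : A ⊕ B →₀ MvPolynomial σ K) :
    sumDesc p q x = p (sumFst K σ A B x) + q (sumSnd K σ A B x) := rfl

@[simp] lemma sumFst_triangularMap (x : A ⊕ B →₀ MvPolynomial σ K) :
    sumFst K σ A' B' (triangularMap p q r x) = sumDesc p q x := by
  simp [triangularMap]

@[simp] lemma sumSnd_triangularMap (x : A ⊕ B →₀ MvPolynomial σ K) :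
    sumSnd K σ A' B' (triangularMap p q r x) = r (sumSnd K σ A B x) := by
  simp [triangularMap]

lemma sum_ext {x y : A ⊕ B →₀ MvPolynomial σ K} (h : sumFst K σ A B x = sumFst K σ A B y)
    (h' : sumSnd K σ A B x = sumSnd K σ A B y) : x = y := by
  rw [← sumInl_add_sumInr x, ← sumInl_add_sumInr y, h, h']

lemma mem_range_sumDesc {y : A' →₀ MvPolynomial σ K} {a : A →₀ MvPolynomial σ K}
    {b : B →₀ MvPolynomial σ K} (h : p a + q b = y) : y ∈ LinearMap.range (sumDesc p q) :=
  ⟨sumInl K σ A B a + sumInr K σ A B b, by simp [sumDesc_apply, h]⟩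

lemma mem_range_triangularMap {y : A' ⊕ B' →₀ MvPolynomial σ K} {a : A →₀ MvPolynomial σ K}
    {b : B →₀ MvPolynomial σ K} (h : p a + q b = sumFst K σ A' B' y)
    (h' : r b = sumSnd K σ A' B' y) : y ∈ LinearMap.range (triangularMap p q r) :=
  ⟨sumInl K σ A B a + sumInr K σ A B b, sum_ext (by simp [sumDesc_apply, h]) (by simp [h'])⟩

lemma mem_range_triangularMap_zero {y : A' ⊕ B' →₀ MvPolynomial σ K} :
    y ∈ LinearMap.range (triangularMap p (0 : (B →₀ MvPolynomial σ K) →ₗ[MvPolynomial σ K] _) r) ↔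
      sumFst K σ A' B' y ∈ LinearMap.range p ∧ sumSnd K σ A' B' y ∈ LinearMap.range r := by
  constructor
  · rintro ⟨x, rfl⟩
    exact ⟨⟨sumFst K σ A B x, by simp [sumDesc_apply]⟩, ⟨sumSnd K σ A B x, by simp⟩⟩
  · rintro ⟨⟨a, ha⟩, b, hb⟩
    exact mem_range_triangularMap (by rw [ha, LinearMap.zero_apply, add_zero]) hb

lemma apply_eq_zero_of_triangularMap_eq_zero {x : A ⊕ B →₀ MvPolynomial σ K}
    (h : triangularMap p q r x = 0) :
    p (sumFst K σ A B x) + q (sumSnd K σ A B x) = 0 ∧ r (sumSnd K σ A B x) = 0 := by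
  rw [← sumDesc_apply, ← sumFst_triangularMap (r := r), ← sumSnd_triangularMap (p := p) (q := q),
    h]
  simp

lemma sumDesc_graded {degA : A → ℕ} {degB : B → ℕ} {degA' : A' → ℕ}
    (hp : IsGraded degA degA' p) (hq : IsGraded degB degA' q) :
    IsGraded (Sum.elim degA degB) degA' (sumDesc p q) :=
  (hp.comp (sumFst_graded _ _)).add (hq.comp (sumSnd_graded _ _))

lemma triangularMap_graded {degA : A → ℕ} {degB : B → ℕ} {degA' : A' → ℕ} {degB' : B' → ℕ}
    (hp : IsGraded degA degA' p) (hq : IsGraded degB degA' q) (hr : IsGraded degB degB' r) :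
    IsGraded (Sum.elim degA degB) (Sum.elim degA' degB') (triangularMap p q r) :=
  ((sumInl_graded _ _).comp (sumDesc_graded hp hq)).add
    ((sumInr_graded _ _).comp (hr.comp (sumSnd_graded _ _)))

lemma sumDesc_mem_irrelevantSubmodule (hp : ∀ x, p x ∈ irrelevantSubmodule K σ A')
    (hq : ∀ x, q x ∈ irrelevantSubmodule K σ A') (x : A ⊕ B →₀ MvPolynomial σ K) :
    sumDesc p q x ∈ irrelevantSubmodule K σ A' :=
  Submodule.add_mem _ (hp _) (hq _)

lemma triangularMap_mem_irrelevantSubmodule (hp : ∀ x, p x ∈ irrelevantSubmodule K σ A')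
    (hq : ∀ x, q x ∈ irrelevantSubmodule K σ A') (hr : ∀ x, r x ∈ irrelevantSubmodule K σ B')
    (x : A ⊕ B →₀ MvPolynomial σ K) :
    triangularMap p q r x ∈ irrelevantSubmodule K σ (A' ⊕ B') :=
  Submodule.add_mem _
    (apply_mem_irrelevantSubmodule (sumInl K σ A' B') (sumDesc_mem_irrelevantSubmodule hp hq x))
    (apply_mem_irrelevantSubmodule (sumInr K σ A' B') (hr _))

variable {D : Type*}

/-- The map `C → A ⊕ B` with components `p` and `-q`. -/
noncomputable def sumDiff
    (p : (C →₀ MvPolynomial σ K) →ₗ[MvPolynomial σ K] (A →₀ MvPolynomial σ K))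
    (q : (C →₀ MvPolynomial σ K) →ₗ[MvPolynomial σ K] (B →₀ MvPolynomial σ K)) :
    (C →₀ MvPolynomial σ K) →ₗ[MvPolynomial σ K] (A ⊕ B →₀ MvPolynomial σ K) :=
  sumInl K σ A B ∘ₗ p + -(sumInr K σ A B ∘ₗ q)

section Diff

variable {p : (C →₀ MvPolynomial σ K) →ₗ[MvPolynomial σ K] (A →₀ MvPolynomial σ K)}
  {q : (C →₀ MvPolynomial σ K) →ₗ[MvPolynomial σ K] (B →₀ MvPolynomial σ K)}

@[simp] lemma sumFst_sumDiff (x : C →₀ MvPolynomial σ K) :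
    sumFst K σ A B (sumDiff p q x) = p x := by simp [sumDiff]

@[simp] lemma sumSnd_sumDiff (x : C →₀ MvPolynomial σ K) :
    sumSnd K σ A B (sumDiff p q x) = -q x := by simp [sumDiff]

lemma sumDiff_graded {degA : A → ℕ} {degB : B → ℕ} {degC : C → ℕ}
    (hp : IsGraded degC degA p) (hq : IsGraded degC degB q) :
    IsGraded degC (Sum.elim degA degB) (sumDiff p q) :=
  ((sumInl_graded _ _).comp hp).add ((sumInr_graded _ _).comp hq).neg

lemma sumDiff_mem_irrelevantSubmodule {x : C →₀ MvPolynomial σ K}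
    (hp : p x ∈ irrelevantSubmodule K σ A) (hq : q x ∈ irrelevantSubmodule K σ B) :
    sumDiff p q x ∈ irrelevantSubmodule K σ (A ⊕ B) :=
  Submodule.add_mem _ (apply_mem_irrelevantSubmodule (sumInl K σ A B) hp)
    (Submodule.neg_mem _ (apply_mem_irrelevantSubmodule (sumInr K σ A B) hq))

lemma triangularMap_sumDiff
    {p' : (D →₀ MvPolynomial σ K) →ₗ[MvPolynomial σ K] (A' →₀ MvPolynomial σ K)}
    {q' : (D →₀ MvPolynomial σ K) →ₗ[MvPolynomial σ K] (B' →₀ MvPolynomial σ K)}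
    {f : (A →₀ MvPolynomial σ K) →ₗ[MvPolynomial σ K] (A' →₀ MvPolynomial σ K)}
    {g : (B →₀ MvPolynomial σ K) →ₗ[MvPolynomial σ K] (B' →₀ MvPolynomial σ K)}
    {x : C →₀ MvPolynomial σ K} {y : D →₀ MvPolynomial σ K}
    (h : f (p x) = p' y) (h' : g (q x) = q' y) :
    triangularMap f 0 g (sumDiff p q x) = sumDiff p' q' y :=
  sum_ext (by simp [sumDesc_apply, h]) (by simp [h'])

lemma sumDesc_id_sumDiff {q : (C →₀ MvPolynomial σ K) →ₗ[MvPolynomial σ K] (A →₀ _)}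
    (h : p = q) (x : C →₀ MvPolynomial σ K) :
    sumDesc LinearMap.id LinearMap.id (sumDiff p q x) = 0 := by
  simp [sumDesc_apply, h]

lemma sumDiff_id_injective :
    Function.Injective (sumDiff (LinearMap.id : (A →₀ MvPolynomial σ K) →ₗ[MvPolynomial σ K] _)
      LinearMap.id) := fun x y h => by
  simpa using congrArg (sumFst K σ A A) h

lemma mem_range_sumDiff_id {x : A ⊕ A →₀ MvPolynomial σ K}
    (h : sumDesc LinearMap.id LinearMap.id x = 0) :
    x ∈ LinearMap.range (sumDiff (LinearMap.id : (A →₀ MvPolynomial σ K) →ₗ[MvPolynomial σ K] _)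
      LinearMap.id) := by
  refine ⟨sumFst K σ A A x, sum_ext (by simp) ?_⟩
  rw [sumSnd_sumDiff, LinearMap.id_apply, neg_eq_iff_add_eq_zero]
  exact h

end Diff

end Triangular

/-- The direct sum of two graded complexes. -/
noncomputable def directSum (F G : GradedComplex K σ) : GradedComplex K σ where
  basis i := F.basis i ⊕ G.basis i
  deg i := Sum.elim (F.deg i) (G.deg i)
  d i := triangularMap (F.d i) 0 (G.d i)
  d_d i x := sum_ext (by simp [sumDesc_apply, F.d_d]) (by simp [G.d_d])
  d_graded i := triangularMap_graded (F.d_graded i) (fun _ _ => by simp) (G.d_graded i)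

lemma directSum_exact {F G : GradedComplex K σ} (hF : F.Exact) (hG : G.Exact) :
    (directSum F G).Exact := by
  intro i x hx
  obtain ⟨h, h'⟩ := apply_eq_zero_of_triangularMap_eq_zero hx
  obtain ⟨y, hy⟩ := hF i _ (by simpa using h)
  obtain ⟨z, hz⟩ := hG i _ h'
  exact mem_range_triangularMap (by rw [hy, LinearMap.zero_apply, add_zero]) hz

lemma mem_range_directSum_d {F G : GradedComplex K σ} {i : ℕ}
    {x : F.basis i ⊕ G.basis i →₀ MvPolynomial σ K} :
    x ∈ LinearMap.range ((directSum F G).d i) ↔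
      sumFst K σ _ _ x ∈ LinearMap.range (F.d i) ∧
        sumSnd K σ _ _ x ∈ LinearMap.range (G.d i) :=
  mem_range_triangularMap_zero

lemma directSum_minimal {F G : GradedComplex K σ} (hF : F.Minimal) (hG : G.Minimal) :
    (directSum F G).Minimal := fun i =>
  triangularMap_mem_irrelevantSubmodule (hF i) (fun _ => zero_mem _) (hG i)

/-- The data needed to form the truncated mapping cone of a chain map `f : W → P`, augmented by
a map `s` from `P₀` to a graded free module vanishing on the image of `f₀`. -/
structure ConeData.{v, u₁, u₂} (K : Type u₁) (σ : Type u₂) [Field K] where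
  W : GradedComplex.{v} K σ
  P : GradedComplex.{v} K σ
  f : ∀ i, W.X i →ₗ[MvPolynomial σ K] P.X i
  f_graded : ∀ i, IsGraded (W.deg i) (P.deg i) (f i)
  f_d : ∀ i x, P.d i (f (i + 1) x) = f i (W.d i x)
  target : Type v
  targetDeg : target → ℕ
  s : P.X 0 →ₗ[MvPolynomial σ K] (target →₀ MvPolynomial σ K)
  s_graded : IsGraded (P.deg 0) targetDeg s
  s_f : ∀ x, s (f 0 x) = 0

/-- The truncated mapping cone. -/
noncomputable def cone (D : ConeData K σ) : GradedComplex K σ where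
  basis
    | 0 => D.target
    | 1 => D.P.basis 1
    | i + 2 => D.P.basis (i + 2) ⊕ D.W.basis (i + 1)
  deg
    | 0 => D.targetDeg
    | 1 => D.P.deg 1
    | i + 2 => Sum.elim (D.P.deg (i + 2)) (D.W.deg (i + 1))
  d
    | 0 => D.s ∘ₗ D.P.d 0
    | 1 => sumDesc (D.P.d 1) (D.f 1)
    | i + 2 => triangularMap (D.P.d (i + 2)) (D.f (i + 2)) (-D.W.d (i + 1))
  d_d
    | 0 => fun (x : D.P.basis 2 ⊕ D.W.basis 1 →₀ MvPolynomial σ K) => by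
      change D.s (D.P.d 0 (sumDesc _ _ x)) = 0
      rw [sumDesc_apply, map_add, D.P.d_d, D.f_d, zero_add, D.s_f]
    | 1 => fun (x : D.P.basis 3 ⊕ D.W.basis 2 →₀ MvPolynomial σ K) => by
      change sumDesc _ _ (triangularMap _ _ _ x) = 0
      rw [sumDesc_apply, sumFst_triangularMap, sumSnd_triangularMap, sumDesc_apply, map_add,
        D.P.d_d, D.f_d, LinearMap.neg_apply, map_neg, zero_add, add_neg_cancel]
    | i + 2 => fun (x : D.P.basis (i + 4) ⊕ D.W.basis (i + 3) →₀ MvPolynomial σ K) => by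
      change triangularMap _ _ _ (triangularMap _ _ _ x) = 0
      refine sum_ext ?_ ?_
      · rw [sumFst_triangularMap, sumDesc_apply, sumFst_triangularMap, sumSnd_triangularMap,
          sumDesc_apply, map_add, D.P.d_d, D.f_d, LinearMap.neg_apply, map_neg, zero_add,
          add_neg_cancel, map_zero]
      · rw [sumSnd_triangularMap, sumSnd_triangularMap, LinearMap.neg_apply, LinearMap.neg_apply,
          map_neg, D.W.d_d, neg_zero, neg_zero, map_zero]
  d_graded
    | 0 => D.s_graded.comp (D.P.d_graded 0)
    | 1 => sumDesc_graded (D.P.d_graded 1) (D.f_graded 1)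
    | i + 2 => triangularMap_graded (D.P.d_graded (i + 2)) (D.f_graded (i + 2))
        (D.W.d_graded (i + 1)).neg

lemma cone_minimal (D : ConeData K σ) (hP : D.P.Minimal) (hW : D.W.Minimal)
    (hf : ∀ i x, D.f (i + 1) x ∈ irrelevantSubmodule K σ (D.P.basis (i + 1))) :
    (cone D).Minimal
  | 0 => sumDesc_mem_irrelevantSubmodule (hP 0) (hf 0)
  | i + 1 => triangularMap_mem_irrelevantSubmodule (hP (i + 1)) (hf (i + 1))
      fun x => Submodule.neg_mem _ (hW i x)

lemma cone_exact (D : ConeData K σ) (hP : D.P.Exact) (hW : D.W.Exact)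
    (hs : ∀ x, D.s x = 0 → x ∈ LinearMap.range (D.f 0))
    (hf : Function.Injective (D.f 0))
    (hr : ∀ x, D.f 0 x ∈ LinearMap.range (D.P.d 0) → x ∈ LinearMap.range (D.W.d 0)) :
    (cone D).Exact := by
  have key (i : ℕ) (x : D.P.basis (i + 2) ⊕ D.W.basis (i + 1) →₀ MvPolynomial σ K)
      (hp : D.P.d (i + 1) (sumFst _ _ _ _ x) + D.f (i + 1) (sumSnd _ _ _ _ x) = 0)
      (hz : D.W.d i (sumSnd _ _ _ _ x) = 0) :
      x ∈ LinearMap.range (triangularMap (D.P.d (i + 2)) (D.f (i + 2)) (-D.W.d (i + 1))) := by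
    obtain ⟨z', hz'⟩ := hW i _ hz
    obtain ⟨p', hp'⟩ := hP (i + 1) (sumFst _ _ _ _ x + D.f (i + 2) z')
      (by rw [map_add, D.f_d, hz', hp])
    refine mem_range_triangularMap (a := p') (b := -z') ?_ ?_
    · rw [hp', map_neg, add_neg_cancel_right]
    · rw [LinearMap.neg_apply, map_neg, neg_neg, hz']
  intro i
  match i with
  | 0 =>
    intro (x : D.P.basis 1 →₀ MvPolynomial σ K) hx
    obtain ⟨r, hr'⟩ := hs _ hx
    obtain ⟨z, hz⟩ := hr r ⟨x, hr'.symm⟩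
    obtain ⟨p, hp⟩ := hP 0 (x - D.f 1 z) (by rw [map_sub, D.f_d, hz, hr', sub_self])
    exact mem_range_sumDesc (by rw [hp, sub_add_cancel])
  | 1 =>
    intro (x : D.P.basis 2 ⊕ D.W.basis 1 →₀ MvPolynomial σ K)
      (hx : D.P.d 1 (sumFst _ _ _ _ x) + D.f 1 (sumSnd _ _ _ _ x) = 0)
    refine key 0 x hx (hf ?_)
    have := congrArg (D.P.d 0) hx
    rwa [map_add, D.P.d_d, D.f_d, zero_add, map_zero, ← map_zero (D.f 0)] at this
  | i + 2 =>
    intro x hx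
    obtain ⟨h, h'⟩ := apply_eq_zero_of_triangularMap_eq_zero hx
    exact key (i + 1) x h (neg_eq_zero.1 h')

end Cone

end GradedComplex

section Resolution

variable {K : Type*} [Field K] {σ : Type*} {I V W : Ideal (MvPolynomial σ K)}

/-- The augmented complex `⋯ → F₁ → F₀ → R` of a resolution `F` of an ideal of `R`. -/
noncomputable def toGradedComplex (F : MinimalFreeResolution I) : GradedComplex.{0} K σ where
  basis
    | 0 => Unit
    | i + 1 => Σ j : ℕ, Fin (F.β i j)
  deg
    | 0 => fun _ => 0
    | _ + 1 => Sigma.fst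
  d
    | 0 => Finsupp.lsingle () ∘ₗ F.ε
    | i + 1 => F.d i
  d_d
    | 0 => fun x => by
      have h : F.d 0 x ∈ LinearMap.ker F.ε := F.exact_at_zero ▸ ⟨x, rfl⟩
      change Finsupp.single () (F.ε (F.d 0 x)) = 0
      rw [LinearMap.mem_ker.1 h, Finsupp.single_zero]
    | i + 1 => fun x => by
      have h : F.d (i + 1) x ∈ LinearMap.ker (F.d i) := F.exact i ▸ ⟨x, rfl⟩
      exact h
  d_graded
    | 0 => isGraded_of_apply_single
      (fun a b => by simpa using F.ε_homog a) (fun _ _ h => absurd h (Nat.not_lt_zero _))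
    | i + 1 => isGraded_of_apply_single (F.d_homog i) fun a b h => F.d_minimal i a b h.le

lemma toGradedComplex_exact (F : MinimalFreeResolution I) : F.toGradedComplex.Exact
  | 0, x, hx => by
    have h : x ∈ LinearMap.ker F.ε := Finsupp.single_eq_zero.1 hx
    rwa [F.exact_at_zero] at h
  | i + 1, x, hx => by
    have h : x ∈ LinearMap.ker (F.d i) := hx
    rwa [F.exact i] at h

lemma toGradedComplex_minimal (F : MinimalFreeResolution I) : F.toGradedComplex.Minimal := by
  refine fun i => apply_mem_of_single (N := irrelevantSubmodule K σ (Σ j, Fin (F.β i j)))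
    (F.d i) fun g g' => ?_
  rcases le_or_gt g.1 g'.1 with h | h
  · rw [F.d_minimal i g g' h, map_zero]
  · have hd : (F.d i (Finsupp.single g 1) g').IsHomogeneous (g.1 - g'.1) := F.d_homog i g g'
    rw [constantCoeff_eq]
    refine hd.coeff_eq_zero ?_
    rw [map_zero]
    omega

lemma mem_range_toGradedComplex_d_zero (F : MinimalFreeResolution I)
    {x : Unit →₀ MvPolynomial σ K} :
    x ∈ LinearMap.range (F.toGradedComplex.d 0) ↔ x () ∈ I := by
  have h : x () ∈ I ↔ ∃ y, F.ε y = x () := by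
    rw [← LinearMap.mem_range, F.ε_range]
  rw [h]
  refine exists_congr fun y => ⟨fun hy => ?_, fun hy => ?_⟩
  · rw [← hy]
    exact Finsupp.single_eq_same.symm
  · change Finsupp.single () (F.ε y) = x
    rw [hy, Finsupp.unique_single x]
    simp

lemma exists_minGens_le {a : σ →₀ ℕ} (ha : monomial a (1 : K) ∈ I) : ∃ b ∈ minGens I, b ≤ a := by
  induction a using WellFoundedLT.induction with
  | ind a ih =>
    by_cases h : a ∈ minGens I
    · exact ⟨a, h, le_rfl⟩
    · obtain ⟨b, hba, hb, hne⟩ : ∃ b ≤ a, monomial b (1 : K) ∈ I ∧ b ≠ a := by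
        by_contra! hcon
        exact h ⟨ha, hcon⟩
      obtain ⟨c, hc, hcb⟩ := ih b (lt_of_le_of_ne hba hne) hb
      exact ⟨c, hc, hcb.trans hba⟩

lemma mem_span_minGens_inf {V U : Ideal (MvPolynomial σ K)} (hV : IsMonomialIdeal V)
    (hU : IsMonomialIdeal U) {r : MvPolynomial σ K} (hr : r ∈ V ⊓ U) :
    r ∈ Ideal.span ((fun a => monomial a (1 : K)) '' minGens (V ⊓ U)) := by
  have key {J : Ideal (MvPolynomial σ K)} (hJ : IsMonomialIdeal J) (hrJ : r ∈ J) (a : σ →₀ ℕ)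
      (ha : a ∈ r.support) : monomial a (1 : K) ∈ J := by
    obtain ⟨S, rfl⟩ := hJ
    rw [mem_ideal_span_monomial_image] at hrJ ⊢
    intro b hb
    obtain rfl : b = a := by simpa using support_monomial_subset hb
    exact hrJ b ha
  exact mem_ideal_span_monomial_image.2 fun a ha =>
    exists_minGens_le ⟨key hV hr.1 a ha, key hU hr.2 a ha⟩

/-- A comparison map of augmented resolutions lifting the identity of the polynomial ring whose
matrix entries in positive spots lie in the irrelevant ideal. -/
structure MinimalComparison (FW : MinimalFreeResolution W) (FV : MinimalFreeResolution V) where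
  map : ∀ i, FW.toGradedComplex.X i →ₗ[MvPolynomial σ K] FV.toGradedComplex.X i
  map_zero : map 0 = (LinearMap.id : (Unit →₀ MvPolynomial σ K) →ₗ[MvPolynomial σ K] _)
  graded : ∀ i, IsGraded (FW.toGradedComplex.deg i) (FV.toGradedComplex.deg i) (map i)
  comm : ∀ i x, FV.toGradedComplex.d i (map (i + 1) x) = map i (FW.toGradedComplex.d i x)
  map_mem : ∀ i x, map (i + 1) x ∈ irrelevantSubmodule K σ (FV.toGradedComplex.basis (i + 1))

lemma nonempty_minimalComparison (FW : MinimalFreeResolution W) (FV : MinimalFreeResolution V)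
    (hW : ∀ r ∈ W, r ∈ Ideal.span ((fun a => monomial a (1 : K)) '' minGens W))
    (f : minGens W → minGens V) (hf : ∀ s, (f s).1 ≤ s)
    (hf' : ∀ (p : ℕ) (w : Fin (p + 1) → minGens W),
      GradedComplex.lcmExponent (f ∘ w) < GradedComplex.lcmExponent w) :
    Nonempty (MinimalComparison FW FV) := by
  let a : (Unit →₀ MvPolynomial σ K) →ₗ[MvPolynomial σ K] ((Fin 0 → minGens W) →₀ _) :=
    Finsupp.lmapDomain _ _ fun _ => Fin.elim0
  let b : ((Fin 0 → minGens V) →₀ MvPolynomial σ K) →ₗ[MvPolynomial σ K] (Unit →₀ _) :=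
    Finsupp.lmapDomain _ _ fun _ => ()
  have hdeg {S : Set (σ →₀ ℕ)} (w : Fin 0 → S) : (GradedComplex.lcmExponent w).degree = 0 := by
    rw [GradedComplex.lcmExponent_zero, map_zero]
  have ha : IsGraded (fun _ => 0) (fun w => (GradedComplex.lcmExponent w).degree) a := by
    refine IsGraded.of_degreePart_apply_single fun u => ?_
    have h := degreePart_single_one (K := K) (σ := σ)
      (degA := fun w : Fin 0 → minGens W => (GradedComplex.lcmExponent w).degree) Fin.elim0
    rw [hdeg] at h
    simpa [a] using h
  have hb : IsGraded (fun w => (GradedComplex.lcmExponent w).degree) (fun _ => 0) b := by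
    refine IsGraded.of_degreePart_apply_single fun w => ?_
    have h := degreePart_single_one (K := K) (σ := σ) (degA := fun _ : Unit => 0) ()
    rw [hdeg]
    simpa [b] using h
  obtain ⟨α, hα0, hα, hαd⟩ := GradedComplex.exists_chainMap FW.toGradedComplex
    (GradedComplex.bar K (minGens W)) (GradedComplex.bar_exact K _) a ha (fun x => by
      have h := (FW.mem_range_toGradedComplex_d_zero).1 ⟨x, rfl⟩
      generalize FW.toGradedComplex.d 0 x = y at h ⊢
      change Unit →₀ MvPolynomial σ K at y
      rw [Finsupp.unique_single y]
      have ha' : a (Finsupp.single () (y ())) = Finsupp.single Fin.elim0 (y ()) :=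
        Finsupp.mapDomain_single
      have h' := GradedComplex.single_mem_range_bar_d_zero K _ _ (hW _ h) Fin.elim0
      rwa [← ha'] at h')
  obtain ⟨β, hβ0, hβ, hβd⟩ := GradedComplex.exists_chainMap
    (GradedComplex.bar K (minGens V)) FV.toGradedComplex FV.toGradedComplex_exact b hb
    (apply_mem_of_single (b ∘ₗ GradedComplex.barDifferential K (minGens V) 0) fun w =>
      (FV.mem_range_toGradedComplex_d_zero).2 (by
        simpa [b, GradedComplex.barDifferential, GradedComplex.lcmExponent_zero,
          GradedComplex.lcmExponent_one] using (w 0).2.1))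
  refine ⟨⟨fun i => β i ∘ₗ GradedComplex.barMap K _ f i ∘ₗ α i, ?_, fun i =>
    (hβ i).comp ((GradedComplex.barMap_graded hf i).comp (hα i)), fun i x => ?_, fun i x =>
    apply_mem_irrelevantSubmodule (β (i + 1))
      (GradedComplex.barMap_mem_irrelevantSubmodule hf' i (α (i + 1) x))⟩⟩
  · have hab : b ∘ₗ GradedComplex.barMap K _ f 0 ∘ₗ a = LinearMap.id := by
      ext1 u
      ext1
      simp [a, b, GradedComplex.barMap, GradedComplex.lcmExponent_zero]
    exact (congrArg₂ (fun u v => v ∘ₗ GradedComplex.barMap K _ f 0 ∘ₗ u) hα0 hβ0).trans hab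
  · exact (hβd i _).trans (congrArg (β i) ((GradedComplex.barMap_d hf i _).trans
      (congrArg (GradedComplex.barMap K _ f i) (hαd i x))))

section Splitting

variable {U : Ideal (MvPolynomial σ K)} {FV : MinimalFreeResolution V}
  {FU : MinimalFreeResolution U} {FW : MinimalFreeResolution W}

open GradedComplex

/-- The mapping cone data of a pair of comparison maps `α` and `β` out of the same resolution. -/
noncomputable def splittingConeData (α : MinimalComparison FW FV) (β : MinimalComparison FW FU) :
    ConeData.{0} K σ where
  W := FW.toGradedComplex
  P := directSum FV.toGradedComplex FU.toGradedComplex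
  f i := sumDiff (α.map i) (β.map i)
  f_graded i := sumDiff_graded (α.graded i) (β.graded i)
  f_d i x := triangularMap_sumDiff (α.comm i x) (β.comm i x)
  target := Unit
  targetDeg _ := 0
  s := sumDesc (LinearMap.id : (Unit →₀ MvPolynomial σ K) →ₗ[MvPolynomial σ K] _) LinearMap.id
  s_graded := sumDesc_graded .id .id
  s_f := sumDesc_id_sumDiff (A := Unit) (α.map_zero.trans β.map_zero.symm)

variable (α : MinimalComparison FW FV) (β : MinimalComparison FW FU)

lemma splittingConeData_f_zero : (splittingConeData α β).f 0 =
    sumDiff (LinearMap.id : (Unit →₀ MvPolynomial σ K) →ₗ[MvPolynomial σ K] _) LinearMap.id :=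
  congrArg₂ sumDiff α.map_zero β.map_zero

lemma splittingCone_minimal : (cone (splittingConeData α β)).Minimal :=
  cone_minimal _ (directSum_minimal FV.toGradedComplex_minimal FU.toGradedComplex_minimal)
    FW.toGradedComplex_minimal fun i x =>
      sumDiff_mem_irrelevantSubmodule (α.map_mem i x) (β.map_mem i x)

lemma mem_range_directSum_d_zero {x : Unit ⊕ Unit →₀ MvPolynomial σ K} :
    x ∈ LinearMap.range ((directSum FV.toGradedComplex FU.toGradedComplex).d 0) ↔
      sumFst K σ Unit Unit x () ∈ V ∧ sumSnd K σ Unit Unit x () ∈ U :=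
  mem_range_directSum_d.trans
    (and_congr FV.mem_range_toGradedComplex_d_zero FU.mem_range_toGradedComplex_d_zero)

lemma splittingCone_exact (hW : V ⊓ U ≤ W) : (cone (splittingConeData α β)).Exact := by
  refine cone_exact _ (directSum_exact FV.toGradedComplex_exact FU.toGradedComplex_exact)
    FW.toGradedComplex_exact ?_ ?_ ?_
  · rw [splittingConeData_f_zero]
    exact fun _ => mem_range_sumDiff_id
  · rw [splittingConeData_f_zero]
    exact sumDiff_id_injective
  · rw [splittingConeData_f_zero]
    intro (x : Unit →₀ MvPolynomial σ K) h
    obtain ⟨h, h'⟩ := (mem_range_directSum_d_zero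
      (x := sumDiff (C := Unit) LinearMap.id LinearMap.id x)).1 h
    rw [sumFst_sumDiff] at h
    rw [sumSnd_sumDiff] at h'
    exact FW.mem_range_toGradedComplex_d_zero.2 (hW ⟨h, neg_mem_iff.1 h'⟩)

lemma mem_range_splittingCone_d_zero {x : Unit →₀ MvPolynomial σ K} :
    x ∈ LinearMap.range ((cone (splittingConeData α β)).d 0) ↔ x () ∈ V ⊔ U := by
  have h : x ∈ LinearMap.range ((cone (splittingConeData α β)).d 0) ↔
      ∃ y ∈ LinearMap.range ((directSum FV.toGradedComplex FU.toGradedComplex).d 0),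
        sumDesc (A := Unit) (B := Unit) LinearMap.id LinearMap.id y = x :=
    ⟨fun ⟨z, hz⟩ => ⟨_, ⟨z, rfl⟩, hz⟩, fun ⟨_, ⟨z, hz⟩, hy⟩ => ⟨z, by subst hz; exact hy⟩⟩
  rw [h, Submodule.mem_sup]
  constructor
  · rintro ⟨y, hy, rfl⟩
    obtain ⟨h, h'⟩ := mem_range_directSum_d_zero.1 hy
    exact ⟨_, h, _, h', rfl⟩
  · rintro ⟨v, hv, u, hu, huv⟩
    refine ⟨sumInl K σ Unit Unit (Finsupp.single () v) + sumInr K σ Unit Unit (Finsupp.single () u),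
      mem_range_directSum_d_zero.2 ?_, ?_⟩
    · simpa using ⟨hv, hu⟩
    · ext1
      simp [sumDesc_apply, huv]

/-- The degree-`j` generators of the `i`-th module of a resolution. -/
def subtypeDegEquiv {I : Ideal (MvPolynomial σ K)} (F : MinimalFreeResolution I) (i j : ℕ) :
    {c // F.toGradedComplex.deg (i + 1) c = j} ≃ Fin (F.β i j) :=
  Equiv.sigmaSubtype (β := fun j => Fin (F.β i j)) j

/-- The degree-`j` generators of the splitting cone in spot `1`. -/
def splittingConeOneEquiv (j : ℕ) :
    {c // (cone (splittingConeData α β)).deg 1 c = j} ≃ Fin (FV.β 0 j) ⊕ Fin (FU.β 0 j) :=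
  Equiv.subtypeSum.trans ((FV.subtypeDegEquiv 0 j).sumCongr (FU.subtypeDegEquiv 0 j))

/-- The degree-`j` generators of the splitting cone in spots greater than `1`. -/
def splittingConeEquiv (i j : ℕ) :
    {c // (cone (splittingConeData α β)).deg (i + 2) c = j} ≃
      (Fin (FV.β (i + 1) j) ⊕ Fin (FU.β (i + 1) j)) ⊕ Fin (FW.β i j) :=
  Equiv.subtypeSum.trans ((Equiv.subtypeSum.trans ((FV.subtypeDegEquiv (i + 1) j).sumCongr
    (FU.subtypeDegEquiv (i + 1) j))).sumCongr (FW.subtypeDegEquiv i j))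

lemma card_deg_eq (FI : MinimalFreeResolution (V ⊔ U)) (hW : V ⊓ U ≤ W) (i j : ℕ)
    [Finite {c // (cone (splittingConeData α β)).deg (i + 1) c = j}] :
    FI.β i j = Nat.card {c // (cone (splittingConeData α β)).deg (i + 1) c = j} := by
  have := Finite.of_equiv _ (FI.subtypeDegEquiv i j).symm
  rw [← Nat.card_fin (FI.β i j), ← Nat.card_congr (FI.subtypeDegEquiv i j)]
  have hC := splittingCone_exact α β hW
  have hr {x : Unit →₀ MvPolynomial σ K} : x ∈ LinearMap.range (FI.toGradedComplex.d 0) ↔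
      x ∈ LinearMap.range ((cone (splittingConeData α β)).d 0) :=
    FI.mem_range_toGradedComplex_d_zero.trans (mem_range_splittingCone_d_zero α β).symm
  refine le_antisymm
    (card_le_card _ _ FI.toGradedComplex_exact hC FI.toGradedComplex_minimal LinearMap.id .id
      (fun x => hr.1 ⟨x, rfl⟩) LinearMap.id .id (fun x => hr.2 ⟨x, rfl⟩) (fun _ => rfl) _ _)
    (card_le_card _ _ hC FI.toGradedComplex_exact (splittingCone_minimal α β) LinearMap.id .id
      (fun x => hr.2 ⟨x, rfl⟩) LinearMap.id .id (fun x => hr.1 ⟨x, rfl⟩) (fun _ => rfl) _ _)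

lemma β_sup_eq (α : MinimalComparison FW FV) (β : MinimalComparison FW FU)
    (FI : MinimalFreeResolution (V ⊔ U)) (hW : V ⊓ U ≤ W) (i j : ℕ) :
    FI.β i j = FV.β i j + FU.β i j + (if i = 0 then 0 else FW.β (i - 1) j) := by
  cases i with
  | zero =>
    have := Finite.of_equiv _ (splittingConeOneEquiv α β j).symm
    rw [card_deg_eq α β FI hW, Nat.card_congr (splittingConeOneEquiv α β j)]
    simp
  | succ i =>
    have := Finite.of_equiv _ (splittingConeEquiv α β i j).symm
    rw [card_deg_eq α β FI hW, Nat.card_congr (splittingConeEquiv α β i j)]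
    simp

end Splitting

end Resolution

end MinimalFreeResolution

/-- Eliahou–Kervaire: if a monomial ideal I = V + U is splittable via a
splitting function w ↦ (φ w, ψ w), then
β_{i,j}(I) = β_{i,j}(V) + β_{i,j}(U) + β_{i-1,j}(V ∩ U) for all i, j ≥ 0
(with the convention β_{-1,j} = 0). -/
theorem eliahou_kervaire_splitting (K : Type*) [Field K] (σ : Type*)
    (I V U : Ideal (MvPolynomial σ K))
    (hI : IsMonomialIdeal I) (hV : IsMonomialIdeal V) (hU : IsMonomialIdeal U)
    (hVne : V ≠ ⊥) (hUne : U ≠ ⊥)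
    (hsum : I = V ⊔ U)
    (hgens : minGens I = minGens V ∪ minGens U)
    (hdisj : minGens V ∩ minGens U = ∅)
    (φ ψ : (σ →₀ ℕ) → (σ →₀ ℕ))
    (hsplit : ∀ w ∈ minGens (V ⊓ U),
      φ w ∈ minGens V ∧ ψ w ∈ minGens U ∧ w = φ w ⊔ ψ w)
    (hS2 : ∀ S : Finset (σ →₀ ℕ), S.Nonempty → ↑S ⊆ minGens (V ⊓ U) →
      S.sup φ < S.sup id ∧ S.sup ψ < S.sup id) :
    ∀ (FI : MinimalFreeResolution I) (FV : MinimalFreeResolution V)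
      (FU : MinimalFreeResolution U) (FW : MinimalFreeResolution (V ⊓ U)),
      ∀ i j : ℕ,
        FI.β i j = FV.β i j + FU.β i j + (if i = 0 then 0 else FW.β (i - 1) j) := by
  intro FI FV FU FW
  have hW : ∀ r ∈ V ⊓ U, r ∈ Ideal.span ((fun a => MvPolynomial.monomial a (1 : K)) ''
      minGens (V ⊓ U)) := fun r => MinimalFreeResolution.mem_span_minGens_inf hV hU
  have hlcm {p : ℕ} (w : Fin (p + 1) → minGens (V ⊓ U)) :
      (Finset.univ.sup fun k => φ (w k)) < (Finset.univ.sup fun k => (w k).1) ∧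
      (Finset.univ.sup fun k => ψ (w k)) < (Finset.univ.sup fun k => (w k).1) := by
    classical
    have h := hS2 (Finset.univ.image fun k => (w k).1) (by simp) (fun _ => by simp; grind)
    rwa [Finset.sup_image, Finset.sup_image, Finset.sup_image] at h
  obtain ⟨α⟩ := MinimalFreeResolution.nonempty_minimalComparison FW FV hW
    (fun w => ⟨φ w, (hsplit w w.2).1⟩)
    (fun w => by conv_rhs => rw [(hsplit w w.2).2.2]
                 exact le_sup_left)
    (fun _ w => (hlcm w).1)
  obtain ⟨β⟩ := MinimalFreeResolution.nonempty_minimalComparison FW FU hW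
    (fun w => ⟨ψ w, (hsplit w w.2).2.1⟩)
    (fun w => by conv_rhs => rw [(hsplit w w.2).2.2]
                 exact le_sup_right)
    (fun _ w => (hlcm w).2)
  subst hsum
  exact MinimalFreeResolution.β_sup_eq α β FI le_rfl
end
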